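/- arXiv:1203.4295 — 2 statements merged into one kernel-verified Lean document; each statement's English description precedes it below -/
import Mathlib

section
/- Let α be irrational with 0 < α < 1 whose negative continued fraction partial quotients satisfy a_i ≤ M for all i and contain no block of N consecutive terms equal to 2; set R = N/(N+1) and let L be the smallest positive integer with R^L ≤ (1 − R)(1 − R²)/(M^N(M² − 1)). Let r, s be positive integers with r ≥ sL, and let (k(i)) be a strictly increasing sequence of positive integers with k(i+1) > k(i) + r for all i. Let 0 < β < 1, not of the form nα + m for integers n, m, with Davenport coefficients (b_i) satisfying: (1) for each i, b_{k(i)+1} = b_{k(i)+2} = ⋯ = b_{k(i)+r} = 0; (2) for each i, no block of N + s consecutive zeros occurs among b_{k(i)+r+1}, …, b_{k(i+1)}; (3) the sequence (b_i) contains no block (b_j, b_{j+1}, …, b_{j+N+s−1}) of the form (a_j − 1, a_{j+1} − 2, …, a_{j+N+s−1} − 2). Then M₊(α,β) = liminf_{i→∞} λ_{k(i)}(β). -/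
open Filter Finset

/-- Distance from `x` to the nearest integer. -/
noncomputable def nint (x : ℝ) : ℝ := |x - (round x : ℝ)|

/-- One-sided inhomogeneous approximation constant
`M₊(α,β) = liminf_{q→∞} q‖qα−β‖` over positive integers `q`. -/
noncomputable def Mplus (α β : ℝ) : ℝ :=
  Filter.liminf (fun q : ℕ => (q : ℝ) * nint (q * α - β)) Filter.atTop

/-- Complete quotients of the negative continued fraction: `ncq α i = α_{i+1}`,
so `ncq α 0 = α₁ = α` and `α_{i+1} = a_i - 1/α_i` with `a_i = ⌈1/α_i⌉`. -/
noncomputable def ncq (α : ℝ) : ℕ → ℝ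
  | 0 => α
  | i + 1 => (⌈(ncq α i)⁻¹⌉ : ℝ) - (ncq α i)⁻¹

/-- Partial quotients of the negative continued fraction: `npq α i = a_i = ⌈1/α_i⌉` for `i ≥ 1`. -/
noncomputable def npq (α : ℝ) (i : ℕ) : ℤ := ⌈(ncq α (i - 1))⁻¹⌉

/-- Convergent denominators: `q₀ = 1`, `q₁ = a₁`, `q_{i+2} = a_{i+2} q_{i+1} − q_i`. -/
noncomputable def nq (α : ℝ) : ℕ → ℤ
  | 0 => 1
  | 1 => npq α 1
  | i + 2 => npq α (i + 2) * nq α (i + 1) - nq α i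

/-- Convergent numerators: `p₀ = 0`, `p₁ = 1`, `p_{i+2} = a_{i+2} p_{i+1} − p_i`. -/
noncomputable def np (α : ℝ) : ℕ → ℤ
  | 0 => 0
  | 1 => 1
  | i + 2 => npq α (i + 2) * np α (i + 1) - np α i

/-- `Dk α k = α₁α₂⋯α_k` (with `Dk α 0 = 1`). -/
noncomputable def Dk (α : ℝ) (k : ℕ) : ℝ := ∏ j ∈ Finset.range k, ncq α j

/-- Davenport remainders: `drem α β i = β_{i+1}`, so `drem α β 0 = β₁ = β` and
`β_{i+1} = β_i/α_i − ⌊β_i/α_i⌋`. -/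
noncomputable def drem (α β : ℝ) : ℕ → ℝ
  | 0 => β
  | i + 1 => Int.fract (drem α β i / ncq α i)

/-- Davenport coefficients: `db α β i = b_i = ⌊β_i/α_i⌋` for `i ≥ 1`. -/
noncomputable def db (α β : ℝ) (i : ℕ) : ℤ := ⌊drem α β (i - 1) / ncq α (i - 1)⌋

/-- `Qn α β n = Σ_{k=1}^n b_k q_{k−1}`. -/
noncomputable def Qn (α β : ℝ) (n : ℕ) : ℤ :=
  ∑ k ∈ Finset.Icc 1 n, db α β k * nq α (k - 1)

/-- `Q′_n`. -/
noncomputable def Qn' (α β : ℝ) (n : ℕ) : ℤ :=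
  if Qn α β n < nq α n - nq α (n - 1) then Qn α β n + nq α (n - 1)
  else Qn α β n + nq α (n - 1) - nq α n

/-- `λ_n(β) = Q_n D_n β_{n+1}`. -/
noncomputable def lam (α β : ℝ) (n : ℕ) : ℝ :=
  (Qn α β n : ℝ) * Dk α n * drem α β n

/-- `ρ_n(β)`. -/
noncomputable def rho (α β : ℝ) (n : ℕ) : ℝ :=
  if Qn α β n < nq α n - nq α (n - 1)
  then (Qn' α β n : ℝ) * Dk α n * (1 - drem α β n)
  else (Qn' α β n : ℝ) * Dk α n * (1 - ncq α n - drem α β n)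

/-- Reversed quotients: `ᾱ₀ = 0`, `ᾱ_i = 1/(a_i − ᾱ_{i−1})`. -/
noncomputable def rq (α : ℝ) : ℕ → ℝ
  | 0 => 0
  | i + 1 => ((npq α (i + 1) : ℝ) - rq α i)⁻¹

section NegativeContinuedFraction

variable {α : ℝ}

/-- The denominators with the index shifted by one, starting from `q₋₁ = 0`. -/
noncomputable def prevDen (α : ℝ) : ℕ → ℤ
  | 0 => 0
  | n + 1 => nq α n

/-- The numerators with the index shifted by one, starting from `p₋₁ = -1`. -/
noncomputable def prevNum (α : ℝ) : ℕ → ℤ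
  | 0 => -1
  | n + 1 => np α n

lemma ncq_spec (hirr : Irrational α) (h0 : 0 < α) (h1 : α < 1) (n : ℕ) :
    Irrational (ncq α n) ∧ 0 < ncq α n ∧ ncq α n < 1 := by
  induction n with
  | zero => exact ⟨hirr, h0, h1⟩
  | succ n ih =>
    have hi : Irrational (ncq α n)⁻¹ := irrational_inv_iff.mpr ih.1
    have hi' : Irrational (ncq α (n + 1)) := by
      simpa [ncq] using hi.intCast_sub ⌈(ncq α n)⁻¹⌉
    refine ⟨hi', ?_, ?_⟩
    · refine lt_of_le_of_ne ?_ (Ne.symm hi'.ne_zero)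
      simpa [ncq] using Int.le_ceil (ncq α n)⁻¹
    · have := Int.ceil_lt_add_one (ncq α n)⁻¹
      simp only [ncq]
      linarith

lemma inv_ncq (α : ℝ) (n : ℕ) : (ncq α n)⁻¹ = npq α (n + 1) - ncq α (n + 1) := by
  simp [npq, ncq]

lemma two_le_npq (hirr : Irrational α) (h0 : 0 < α) (h1 : α < 1) (n : ℕ) :
    2 ≤ npq α (n + 1) := by
  obtain ⟨-, hp, hl⟩ := ncq_spec hirr h0 h1 n
  have h : (1 : ℤ) < ⌈(ncq α n)⁻¹⌉ := Int.lt_ceil.mpr (by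
    push_cast
    exact (one_lt_inv₀ hp).mpr hl)
  simp only [npq, Nat.add_sub_cancel]
  omega

lemma prevDen_add_two (α : ℝ) (n : ℕ) :
    prevDen α (n + 2) = npq α (n + 1) * prevDen α (n + 1) - prevDen α n := by
  cases n <;> simp [prevDen, nq]

lemma prevNum_add_two (α : ℝ) (n : ℕ) :
    prevNum α (n + 2) = npq α (n + 1) * prevNum α (n + 1) - prevNum α n := by
  cases n <;> simp [prevNum, np]

lemma prevDen_spec (hirr : Irrational α) (h0 : 0 < α) (h1 : α < 1) (n : ℕ) :
    0 ≤ prevDen α n ∧ prevDen α n < prevDen α (n + 1) := by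
  induction n with
  | zero => simp [prevDen, nq]
  | succ n ih =>
    have h2 := two_le_npq hirr h0 h1 n
    rw [prevDen_add_two]
    refine ⟨by linarith, ?_⟩
    nlinarith

lemma le_prevDen (hirr : Irrational α) (h0 : 0 < α) (h1 : α < 1) (n : ℕ) :
    (n : ℤ) ≤ prevDen α n := by
  induction n with
  | zero => simp [prevDen]
  | succ n ih =>
    have := (prevDen_spec hirr h0 h1 n).2
    push_cast
    omega

lemma nq_pos (hirr : Irrational α) (h0 : 0 < α) (h1 : α < 1) (n : ℕ) : 0 < nq α n := by
  have := prevDen_spec hirr h0 h1 n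
  simp only [prevDen] at this
  omega

lemma Dk_succ (α : ℝ) (n : ℕ) : Dk α (n + 1) = Dk α n * ncq α n :=
  Finset.prod_range_succ _ _

lemma Dk_pos (hirr : Irrational α) (h0 : 0 < α) (h1 : α < 1) (n : ℕ) : 0 < Dk α n :=
  Finset.prod_pos fun j _ => (ncq_spec hirr h0 h1 j).2.1

lemma Dk_add_two (hirr : Irrational α) (h0 : 0 < α) (h1 : α < 1) (n : ℕ) :
    Dk α (n + 2) = npq α (n + 1) * Dk α (n + 1) - Dk α n := by
  have hp := (ncq_spec hirr h0 h1 n).2.1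
  have h := inv_ncq α n
  have h' : ncq α (n + 1) = npq α (n + 1) - (ncq α n)⁻¹ := by linarith
  rw [Dk_succ, Dk_succ, h']
  field_simp

lemma Dk_eq (hirr : Irrational α) (h0 : 0 < α) (h1 : α < 1) (n : ℕ) :
    Dk α n = prevDen α n * α - prevNum α n := by
  induction n using Nat.twoStepInduction with
  | zero => simp [Dk, prevDen, prevNum]
  | one => simp [Dk, prevDen, prevNum, nq, np, ncq]
  | more n ih ih' =>
    rw [Dk_add_two hirr h0 h1, ih, ih', prevDen_add_two, prevNum_add_two]
    push_cast
    ring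

lemma prevDen_mul_Dk_sub (hirr : Irrational α) (h0 : 0 < α) (h1 : α < 1) (n : ℕ) :
    (prevDen α (n + 1) : ℝ) * Dk α n - prevDen α n * Dk α (n + 1) = 1 := by
  induction n with
  | zero => simp [prevDen, nq, Dk]
  | succ n ih =>
    rw [Dk_add_two hirr h0 h1, prevDen_add_two]
    push_cast
    linarith

lemma exists_lattice_coords (α : ℝ) (n : ℕ) (h h' : ℤ) :
    ∃ x y : ℤ, h = x * prevDen α (n + 1) + y * prevDen α n ∧
      h' = x * prevNum α (n + 1) + y * prevNum α n := by
  induction n with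
  | zero => exact ⟨h, -h', by simp [prevDen, nq], by simp [prevNum, np]⟩
  | succ n ih =>
    obtain ⟨x, y, hx, hy⟩ := ih
    refine ⟨-y, x + npq α (n + 1) * y, ?_, ?_⟩
    · rw [hx, prevDen_add_two]; ring
    · rw [hy, prevNum_add_two]; ring

/-- The values of `hα - h'` avoid a neighbourhood of zero when `h` is a small nonzero integer. -/
lemma le_or_le_of_small (hirr : Irrational α) (h0 : 0 < α) (h1 : α < 1) (n : ℕ) (h h' : ℤ)
    (hne : h ≠ 0) (hlo : prevDen α (n + 1) - prevDen α (n + 2) < h) (hhi : h < prevDen α (n + 2)) :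
    Dk α (n + 1) ≤ h * α - h' ∨ h * α - h' ≤ -(Dk α (n + 1) - Dk α (n + 2)) := by
  obtain ⟨x, y, hx, hy⟩ := exists_lattice_coords α (n + 1) h h'
  have hd : (h : ℝ) * α - h' = x * Dk α (n + 2) + y * Dk α (n + 1) := by
    rw [Dk_eq hirr h0 h1, Dk_eq hirr h0 h1, hx, hy]
    push_cast
    ring
  rw [hd]
  have hu : 0 < prevDen α (n + 1) := by
    have := prevDen_spec hirr h0 h1 n
    omega
  have huv := (prevDen_spec hirr h0 h1 (n + 1)).2
  have hE := Dk_pos hirr h0 h1 (n + 2)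
  have hED : Dk α (n + 2) < Dk α (n + 1) := by
    have := Dk_succ α (n + 1)
    have := Dk_pos hirr h0 h1 (n + 1)
    have := (ncq_spec hirr h0 h1 (n + 1)).2.2
    nlinarith
  rw [show n + 1 + 1 = n + 2 from rfl] at *
  generalize Dk α (n + 2) = E at *
  generalize Dk α (n + 1) = D at *
  generalize prevDen α (n + 2) = v at *
  generalize prevDen α (n + 1) = u at *
  subst hx
  rcases le_or_gt 1 y with hy1 | hy0
  · left
    have hx0 : x ≤ 0 := by
      by_contra! hc
      nlinarith
    rcases eq_or_lt_of_le hx0 with rfl | hx1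
    · have : (1 : ℝ) ≤ y := by exact_mod_cast hy1
      push_cast
      nlinarith
    · have hyx : -x + 1 ≤ y := by
        by_contra! hc
        nlinarith
      have h3 : -(x : ℝ) + 1 ≤ y := by exact_mod_cast hyx
      have h4 : (x : ℝ) ≤ -1 := by exact_mod_cast (by omega : x ≤ -1)
      nlinarith
  · right
    rcases le_or_gt x 0 with hx0 | hx1
    · have hy1 : y ≤ -1 := by
        by_contra! hc
        obtain rfl : y = 0 := by omega
        rcases eq_or_lt_of_le hx0 with rfl | hx1
        · simp at hne
        · nlinarith
      have h3 : (y : ℝ) ≤ -1 := by exact_mod_cast hy1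
      have h4 : (x : ℝ) ≤ 0 := by exact_mod_cast hx0
      nlinarith
    · have hyx : y ≤ -x := by
        by_contra! hc
        nlinarith
      have h3 : (y : ℝ) ≤ -x := by exact_mod_cast hyx
      have h4 : (1 : ℝ) ≤ x := by exact_mod_cast hx1
      nlinarith

/-- If `α_{n+1} > j/(j+1)` then `a_{n+1} = ⋯ = a_{n+j} = 2`. -/
lemma npq_eq_two_of_lt_ncq (hirr : Irrational α) (h0 : 0 < α) (h1 : α < 1) (j n : ℕ)
    (h : (j : ℝ) < (j + 1) * ncq α n) (k : ℕ) (hk : k < j) : npq α (n + 1 + k) = 2 := by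
  induction j generalizing n k with
  | zero => omega
  | succ j ih =>
    obtain ⟨-, hp, -⟩ := ncq_spec hirr h0 h1 n
    obtain ⟨-, hp', hl'⟩ := ncq_spec hirr h0 h1 (n + 1)
    have h2 := two_le_npq hirr h0 h1 n
    have hinv : 1 = ncq α n * (npq α (n + 1) - ncq α (n + 1)) := by
      rw [← inv_ncq, mul_inv_cancel₀ hp.ne']
    have hj : (0 : ℝ) ≤ j := j.cast_nonneg
    push_cast at h
    have ha : npq α (n + 1) = 2 := by
      by_contra hc
      have h3 : (3 : ℝ) ≤ npq α (n + 1) := by exact_mod_cast (by omega : 3 ≤ npq α (n + 1))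
      nlinarith
    rcases k with _ | k
    · simpa using ha
    · rw [show n + 1 + (k + 1) = n + 1 + 1 + k by ring]
      refine ih (n + 1) ?_ k (by omega)
      rw [ha] at hinv
      push_cast at hinv
      by_contra! hc
      nlinarith

/-- If `q_{n-1}/q_n > j/(j+1)` then `a_n = ⋯ = a_{n-j+1} = 2`. -/
lemma npq_eq_two_of_lt_prevDen (hirr : Irrational α) (h0 : 0 < α) (h1 : α < 1) (j n : ℕ)
    (h : (j : ℤ) * prevDen α (n + 1) < (j + 1) * prevDen α n) :
    j ≤ n ∧ ∀ k, n < k + j → k ≤ n → npq α k = 2 := by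
  induction j generalizing n with
  | zero => exact ⟨by omega, by omega⟩
  | succ j ih =>
    rcases n with _ | n
    · simp only [prevDen, nq] at h
      push_cast at h
      omega
    · have h2 := two_le_npq hirr h0 h1 n
      have hs := prevDen_spec hirr h0 h1 n
      rw [show n + 1 + 1 = n + 2 from rfl, prevDen_add_two] at h
      push_cast at h
      have hj : (0 : ℤ) ≤ j := by positivity
      have ha : npq α (n + 1) = 2 := by
        by_contra hc
        have h3 : 3 ≤ npq α (n + 1) := by omega
        have h4 : 0 ≤ ((j : ℤ) + 1) * prevDen α (n + 1) := by nlinarith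
        nlinarith [mul_le_mul_of_nonneg_right h3 h4]
      obtain ⟨hle, hk⟩ := ih n (by rw [ha] at h; linarith)
      refine ⟨by omega, fun k hk1 hk2 => ?_⟩
      rcases Nat.lt_or_ge n k with hc | hc
      · rwa [show k = n + 1 by omega]
      · exact hk k (by omega) hc

end NegativeContinuedFraction

section DavenportExpansion

variable {α : ℝ}

lemma drem_spec (β : ℝ) (hβ0 : 0 < β) (hβ1 : β < 1) (n : ℕ) :
    0 ≤ drem α β n ∧ drem α β n < 1 := by
  cases n with
  | zero => exact ⟨hβ0.le, hβ1⟩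
  | succ n => exact ⟨Int.fract_nonneg _, Int.fract_lt_one _⟩

lemma drem_eq (hirr : Irrational α) (h0 : 0 < α) (h1 : α < 1) (β : ℝ) (n : ℕ) :
    drem α β n = ncq α n * (db α β (n + 1) + drem α β (n + 1)) := by
  have hp := (ncq_spec hirr h0 h1 n).2.1
  simp only [db, drem, Nat.add_sub_cancel, Int.floor_add_fract]
  field_simp

lemma db_nonneg (hirr : Irrational α) (h0 : 0 < α) (h1 : α < 1) {β : ℝ} (hβ0 : 0 < β)
    (hβ1 : β < 1) (n : ℕ) : 0 ≤ db α β (n + 1) :=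
  Int.floor_nonneg.mpr (div_nonneg (drem_spec β hβ0 hβ1 n).1 (ncq_spec hirr h0 h1 n).2.1.le)

lemma Qn_succ (α β : ℝ) (n : ℕ) : Qn α β (n + 1) = Qn α β n + db α β (n + 1) * nq α n := by
  simp [Qn, Finset.sum_Icc_succ_top]

lemma Qn_monotone (hirr : Irrational α) (h0 : 0 < α) (h1 : α < 1) {β : ℝ} (hβ0 : 0 < β)
    (hβ1 : β < 1) : Monotone (Qn α β) := by
  refine monotone_nat_of_le_succ fun n => ?_
  rw [Qn_succ]
  have := mul_nonneg (db_nonneg hirr h0 h1 hβ0 hβ1 n) (nq_pos hirr h0 h1 n).le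
  omega

lemma Qn_nonneg (hirr : Irrational α) (h0 : 0 < α) (h1 : α < 1) {β : ℝ} (hβ0 : 0 < β)
    (hβ1 : β < 1) (n : ℕ) : 0 ≤ Qn α β n := by
  have := Qn_monotone hirr h0 h1 hβ0 hβ1 (Nat.zero_le n)
  simpa [Qn] using this

lemma exists_Qn_mul_sub (hirr : Irrational α) (h0 : 0 < α) (h1 : α < 1) (β : ℝ) (n : ℕ) :
    ∃ P : ℤ, (Qn α β n : ℝ) * α - P = β - Dk α n * drem α β n := by
  induction n with
  | zero => exact ⟨0, by simp [Qn, Dk, drem]⟩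
  | succ n ih =>
    obtain ⟨P, hP⟩ := ih
    refine ⟨P + db α β (n + 1) * np α n, ?_⟩
    have hD := Dk_eq hirr h0 h1 (n + 1)
    have hD' := Dk_succ α n
    have hr := drem_eq hirr h0 h1 β n
    simp only [prevDen, prevNum] at hD
    rw [hr] at hP
    rw [Qn_succ]
    push_cast
    have : Dk α n * (ncq α n * (db α β (n + 1) + drem α β (n + 1))) =
        Dk α (n + 1) * drem α β (n + 1) + db α β (n + 1) * (nq α n * α - np α n) := by
      rw [← hD, hD']
      ring
    linarith

/-- The remainder `β_{n+1}` is confined once the partial sum `Q_n` is large. -/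
lemma Qn_lt_nq_and (hirr : Irrational α) (h0 : 0 < α) (h1 : α < 1) {β : ℝ} (hβ0 : 0 < β)
    (hβ1 : β < 1) (n : ℕ) :
    Qn α β n < prevDen α (n + 1) ∧
      (prevDen α (n + 1) - prevDen α n ≤ Qn α β n → drem α β n < 1 - ncq α n) := by
  induction n with
  | zero => simp [Qn, prevDen, nq]
  | succ n ih =>
    obtain ⟨ih1, ih2⟩ := ih
    obtain ⟨-, hp, -⟩ := ncq_spec hirr h0 h1 n
    obtain ⟨-, hp', -⟩ := ncq_spec hirr h0 h1 (n + 1)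
    have hs := prevDen_spec hirr h0 h1 n
    have hr := drem_eq hirr h0 h1 β n
    have hd := (drem_spec (α := α) β hβ0 hβ1 n).2
    have hd' := (drem_spec (α := α) β hβ0 hβ1 (n + 1)).1
    have hinv : 1 = ncq α n * (npq α (n + 1) - ncq α (n + 1)) := by
      rw [← inv_ncq, mul_inv_cancel₀ hp.ne']
    rw [prevDen_add_two, Qn_succ, show nq α n = prevDen α (n + 1) from rfl]
    set a := npq α (n + 1)
    set b := db α β (n + 1)
    set u := prevDen α n
    set v := prevDen α (n + 1)
    set C := ncq α (n + 1)
    set e := drem α β (n + 1)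
    by_cases hq : v - u ≤ Qn α β n
    · have h3 := ih2 hq
      have h4 : (b : ℝ) + e < a - 1 - C := by
        by_contra! hc
        nlinarith
      have hb : b ≤ a - 2 := by
        have : (b : ℝ) < a - 1 := by linarith
        have : b < a - 1 := by exact_mod_cast this
        omega
      refine ⟨by nlinarith, fun hc => ?_⟩
      have hb' : b = a - 2 := by
        by_contra hne
        have : b ≤ a - 3 := by omega
        nlinarith
      rw [hb'] at h4
      push_cast at h4
      linarith
    · push Not at hq
      have h4 : (b : ℝ) + e < a - C := by
        by_contra! hc
        nlinarith
      have hb : b ≤ a - 1 := by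
        have : (b : ℝ) < a := by linarith
        have : b < a := by exact_mod_cast this
        omega
      refine ⟨by nlinarith, fun hc => ?_⟩
      have hb' : b = a - 1 := by
        by_contra hne
        have : b ≤ a - 2 := by omega
        nlinarith
      rw [hb'] at h4
      push_cast at h4
      linarith

lemma Qn_eq_and_of_db_eq_zero (hirr : Irrational α) (h0 : 0 < α) (h1 : α < 1) (β : ℝ) {m n : ℕ}
    (hmn : m ≤ n) (hz : ∀ j, m < j → j ≤ n → db α β j = 0) :
    Qn α β n = Qn α β m ∧ Dk α n * drem α β n = Dk α m * drem α β m := by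
  induction n, hmn using Nat.le_induction with
  | base => simp
  | succ n hmn ih =>
    obtain ⟨ihQ, ihD⟩ := ih fun j hj hj' => hz j hj (by omega)
    have hb := hz (n + 1) (by omega) le_rfl
    refine ⟨by rw [Qn_succ, hb, ihQ]; ring, ?_⟩
    rw [← ihD, drem_eq hirr h0 h1 β n, hb, Dk_succ]
    push_cast
    ring

/-- A lower bound for `1 - α_{n+1} - β_{n+1}` when the expansion does not start with a long run of
coefficients `a - 2`. -/
lemma le_one_sub_ncq_sub_drem (hirr : Irrational α) (h0 : 0 < α) (h1 : α < 1) {β : ℝ}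
    (hβ0 : 0 < β) (hβ1 : β < 1) {R μ : ℝ} (hR : ∀ n, ncq α n ≤ R) (hR1 : R ≤ 1)
    (hμ0 : 0 ≤ μ) (hμ1 : μ ≤ 1) (hμ : ∀ n, μ ≤ ncq α n) (K n : ℕ)
    (hlt : drem α β n < 1 - ncq α n)
    (h : ∃ l, n < l ∧ l ≤ n + K ∧ db α β l ≠ npq α l - 2) :
    (1 - R) * μ ^ K ≤ 1 - ncq α n - drem α β n := by
  induction K generalizing n with
  | zero =>
    obtain ⟨l, hl, hl', -⟩ := h
    omega
  | succ K ih =>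
    obtain ⟨-, hp, -⟩ := ncq_spec hirr h0 h1 n
    have hr := drem_eq hirr h0 h1 β n
    have hd' := drem_spec (α := α) β hβ0 hβ1 (n + 1)
    have hp' := (ncq_spec hirr h0 h1 (n + 1)).2.1
    have hinv : 1 = ncq α n * (npq α (n + 1) - ncq α (n + 1)) := by
      rw [← inv_ncq, mul_inv_cancel₀ hp.ne']
    have key : 1 - ncq α n - drem α β n = ncq α n *
        (npq α (n + 1) - 1 - ncq α (n + 1) - db α β (n + 1) - drem α β (n + 1)) := by
      rw [hr]
      linear_combination hinv
    have hpow : μ ^ K ≤ 1 := pow_le_one₀ hμ0 hμ1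
    have hpow0 : 0 ≤ μ ^ K := pow_nonneg hμ0 K
    suffices hs : (1 - R) * μ ^ K ≤
        npq α (n + 1) - 1 - ncq α (n + 1) - db α β (n + 1) - drem α β (n + 1) by
      rw [key, pow_succ]
      have := mul_le_mul (hμ n) hs (mul_nonneg (by linarith) hpow0) hp.le
      linarith
    have hb : db α β (n + 1) ≤ npq α (n + 1) - 2 := by
      have h4 : (db α β (n + 1) : ℝ) < npq α (n + 1) - 1 := by
        by_contra! hc
        nlinarith
      have : db α β (n + 1) < npq α (n + 1) - 1 := by exact_mod_cast h4
      omega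
    by_cases hb' : db α β (n + 1) = npq α (n + 1) - 2
    · have hc : (db α β (n + 1) : ℝ) = npq α (n + 1) - 2 := by exact_mod_cast hb'
      have hlt' : drem α β (n + 1) < 1 - ncq α (n + 1) := by
        by_contra! hcon
        nlinarith
      have := ih (n + 1) hlt' (by
        obtain ⟨l, hl, hl', hne⟩ := h
        refine ⟨l, ?_, by omega, hne⟩
        rcases eq_or_ne l (n + 1) with rfl | hl''
        · exact absurd hb' hne
        · omega)
      rw [hc]
      linarith
    · have hc : (db α β (n + 1) : ℝ) ≤ npq α (n + 1) - 3 := by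
        exact_mod_cast (by omega : db α β (n + 1) ≤ npq α (n + 1) - 3)
      have := hR (n + 1)
      nlinarith

/-- A lower bound for `1 - β_{n+1}` when the expansion does not start with a long block
`a - 1, a - 2, …, a - 2`. -/
lemma le_one_sub_drem (hirr : Irrational α) (h0 : 0 < α) (h1 : α < 1) {β : ℝ}
    (hβ0 : 0 < β) (hβ1 : β < 1) {R μ : ℝ} (hR : ∀ n, ncq α n ≤ R) (hR1 : R ≤ 1)
    (hμ0 : 0 ≤ μ) (hμ1 : μ ≤ 1) (hμ : ∀ n, μ ≤ ncq α n) (K n : ℕ)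
    (h : ¬ (db α β (n + 1) = npq α (n + 1) - 1 ∧
      ∀ l, n + 1 < l → l < n + 1 + (K + 1) → db α β l = npq α l - 2)) :
    (1 - R) * μ ^ (K + 1) ≤ 1 - drem α β n := by
  obtain ⟨-, hp, -⟩ := ncq_spec hirr h0 h1 n
  have hr := drem_eq hirr h0 h1 β n
  have hd := drem_spec (α := α) β hβ0 hβ1 n
  have hd' := drem_spec (α := α) β hβ0 hβ1 (n + 1)
  have hp' := (ncq_spec hirr h0 h1 (n + 1)).2.1
  have hinv : 1 = ncq α n * (npq α (n + 1) - ncq α (n + 1)) := by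
    rw [← inv_ncq, mul_inv_cancel₀ hp.ne']
  have key : 1 - drem α β n = ncq α n *
      (npq α (n + 1) - ncq α (n + 1) - db α β (n + 1) - drem α β (n + 1)) := by
    rw [hr]
    linear_combination hinv
  have hpow : μ ^ K ≤ 1 := pow_le_one₀ hμ0 hμ1
  have hpow0 : 0 ≤ μ ^ K := pow_nonneg hμ0 K
  suffices hs : (1 - R) * μ ^ K ≤
      npq α (n + 1) - ncq α (n + 1) - db α β (n + 1) - drem α β (n + 1) by
    rw [key, pow_succ]
    have := mul_le_mul (hμ n) hs (mul_nonneg (by linarith) hpow0) hp.le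
    linarith
  have hb : db α β (n + 1) ≤ npq α (n + 1) - 1 := by
    have h4 : (db α β (n + 1) : ℝ) < npq α (n + 1) := by
      by_contra! hc
      nlinarith
    have : db α β (n + 1) < npq α (n + 1) := by exact_mod_cast h4
    omega
  by_cases hb' : db α β (n + 1) = npq α (n + 1) - 1
  · have hc : (db α β (n + 1) : ℝ) = npq α (n + 1) - 1 := by exact_mod_cast hb'
    have hlt' : drem α β (n + 1) < 1 - ncq α (n + 1) := by
      by_contra! hcon
      nlinarith
    have := le_one_sub_ncq_sub_drem hirr h0 h1 hβ0 hβ1 hR hR1 hμ0 hμ1 hμ K (n + 1) hlt' (by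
      by_contra! hcon
      exact h ⟨hb', fun l hl hl' => hcon l hl (by omega)⟩)
    rw [hc]
    linarith
  · have hc : (db α β (n + 1) : ℝ) ≤ npq α (n + 1) - 2 := by
      exact_mod_cast (by omega : db α β (n + 1) ≤ npq α (n + 1) - 2)
    have := hR (n + 1)
    nlinarith

end DavenportExpansion

section Bounds

variable {α : ℝ}

lemma Dk_add_le (hirr : Irrational α) (h0 : 0 < α) (h1 : α < 1) {R : ℝ}
    (hR : ∀ n, ncq α n ≤ R) (n r : ℕ) : Dk α (n + r) ≤ Dk α n * R ^ r := by
  induction r with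
  | zero => simp
  | succ r ih =>
    rw [← add_assoc, Dk_succ, pow_succ, ← mul_assoc]
    exact mul_le_mul ih (hR _) (ncq_spec hirr h0 h1 _).2.1.le
      ((Dk_pos hirr h0 h1 _).le.trans ih)

lemma le_Dk_add (hirr : Irrational α) (h0 : 0 < α) (h1 : α < 1) {μ : ℝ} (hμ0 : 0 ≤ μ)
    (hμ : ∀ n, μ ≤ ncq α n) (n r : ℕ) : Dk α n * μ ^ r ≤ Dk α (n + r) := by
  induction r with
  | zero => simp
  | succ r ih =>
    rw [← add_assoc, Dk_succ, pow_succ, ← mul_assoc]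
    exact mul_le_mul ih (hμ _) hμ0 (Dk_pos hirr h0 h1 _).le

lemma one_le_mul_prevDen_mul_Dk (hirr : Irrational α) (h0 : 0 < α) (h1 : α < 1) {c : ℝ}
    (hc : ∀ n, Dk α n ≤ c * Dk α (n + 1)) (n : ℕ) :
    1 ≤ c * (prevDen α (n + 1) * Dk α (n + 1)) := by
  have h := prevDen_mul_Dk_sub hirr h0 h1 n
  have hs := prevDen_spec hirr h0 h1 n
  have hu : (0 : ℝ) ≤ prevDen α n := by exact_mod_cast hs.1
  have hv : (0 : ℝ) ≤ prevDen α (n + 1) := by exact_mod_cast hs.1.trans hs.2.le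
  have h2 := mul_le_mul_of_nonneg_left (hc n) hv
  have h3 := mul_nonneg hu (Dk_pos hirr h0 h1 (n + 1)).le
  linarith

/-- A positive integer `q` is either a partial sum `Q_n` or a poor approximation. -/
lemma exists_lam_le_or_le (hirr : Irrational α) (h0 : 0 < α) (h1 : α < 1) {β : ℝ}
    (hβ0 : 0 < β) (hβ1 : β < 1) {R μ c : ℝ} (hR : ∀ n, ncq α n ≤ R) (hR1 : R ≤ 1)
    (hμ0 : 0 ≤ μ) (hμ1 : μ ≤ 1) (hμ : ∀ n, μ ≤ ncq α n)
    (hc1 : 1 ≤ c) (hc : ∀ n, Dk α n ≤ c * Dk α (n + 1)) (K : ℕ)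
    (h : ∀ n, ¬ (db α β (n + 1) = npq α (n + 1) - 1 ∧
      ∀ l, n + 1 < l → l < n + 1 + (K + 1) → db α β l = npq α l - 2)) (q : ℕ) (hq : 0 < q) :
    (∃ n, Qn α β n = q ∧ lam α β n ≤ q * nint (q * α - β)) ∨
      (1 - R) * μ ^ (K + 1) ≤ c * (q * nint (q * α - β)) := by
  have hex : ∃ n, (q : ℤ) < prevDen α n :=
    ⟨q + 1, by have := le_prevDen hirr h0 h1 (q + 1); push_cast at this; omega⟩
  obtain ⟨m, hm1, hm2⟩ : ∃ m, (q : ℤ) < prevDen α (m + 2) ∧ prevDen α (m + 1) ≤ q := by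
    classical
    have hf := Nat.find_spec hex
    have hmin := fun k => Nat.find_min (m := k) hex
    rcases hn : Nat.find hex with _ | _ | m
    · rw [hn] at hf
      simp only [prevDen] at hf
      omega
    · rw [hn] at hf
      simp only [prevDen, nq] at hf
      omega
    · rw [hn] at hf
      exact ⟨m, hf, not_lt.mp (hmin (m + 1) (by omega))⟩
  obtain ⟨P, hP⟩ := exists_Qn_mul_sub hirr h0 h1 β (m + 1)
  have hQ0 := Qn_nonneg hirr h0 h1 hβ0 hβ1 (m + 1)
  have hQ1 : Qn α β (m + 1) < prevDen α (m + 2) :=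
    (Qn_lt_nq_and hirr h0 h1 hβ0 hβ1 (m + 1)).1
  have hd := drem_spec (α := α) β hβ0 hβ1 (m + 1)
  have hD := Dk_pos hirr h0 h1 (m + 1)
  have hpow1 : μ ^ (K + 1) ≤ 1 := pow_le_one₀ hμ0 hμ1
  have hpow0 : 0 ≤ μ ^ (K + 1) := pow_nonneg hμ0 _
  have hq1 : (1 : ℝ) ≤ q := by exact_mod_cast hq
  set p := round ((q : ℝ) * α - β) with hp
  have hnint : nint ((q : ℝ) * α - β) = |q * α - β - p| := rfl
  have hdiff : (q : ℝ) * α - β - p = (((q : ℤ) - Qn α β (m + 1) : ℤ) : ℝ) * α - ((p - P : ℤ) : ℝ) -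
      Dk α (m + 1) * drem α β (m + 1) := by
    push_cast
    linarith
  by_cases hz : (q : ℤ) - Qn α β (m + 1) = 0
  · have hqQ : Qn α β (m + 1) = q := by omega
    rw [hz] at hdiff
    by_cases hpP : p - P = 0
    · left
      refine ⟨m + 1, hqQ, ?_⟩
      rw [hpP] at hdiff
      rw [hnint, hdiff, lam, hqQ]
      simp only [Int.cast_zero, zero_mul, zero_sub, sub_zero, abs_neg]
      rw [abs_of_nonneg (mul_nonneg hD.le hd.1)]
      push_cast
      rw [mul_assoc]
    · right
      have h3 : (1 : ℝ) ≤ |((p - P : ℤ) : ℝ)| := by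
        exact_mod_cast Int.one_le_abs hpP
      have hD1 : Dk α (m + 1) ≤ R := by
        have h4 := Dk_add_le hirr h0 h1 (fun n => (ncq_spec hirr h0 h1 n).2.2.le) 0 m
        have h5 : Dk α 0 = 1 := by simp [Dk]
        rw [h5] at h4
        simp only [zero_add, one_pow, mul_one] at h4
        rw [Dk_succ]
        have := hR m
        have := (ncq_spec hirr h0 h1 m).2.1
        nlinarith
      have h6 : 1 - R ≤ nint ((q : ℝ) * α - β) := by
        rw [hnint, hdiff]
        have h7 := abs_sub_abs_le_abs_sub ((p - P : ℤ) : ℝ) (-(Dk α (m + 1) * drem α β (m + 1)))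
        rw [abs_neg, abs_of_nonneg (mul_nonneg hD.le hd.1)] at h7
        have h8 : |((0 : ℤ) : ℝ) * α - ((p - P : ℤ) : ℝ) - Dk α (m + 1) * drem α β (m + 1)| =
            |((p - P : ℤ) : ℝ) - -(Dk α (m + 1) * drem α β (m + 1))| := by
          rw [← abs_neg]
          congr 1
          push_cast
          ring
        rw [h8]
        nlinarith
      have h9 : 0 ≤ nint ((q : ℝ) * α - β) := abs_nonneg _
      have h10 : nint ((q : ℝ) * α - β) ≤ q * nint ((q : ℝ) * α - β) := le_mul_of_one_le_left h9 hq1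
      have h11 : q * nint ((q : ℝ) * α - β) ≤ c * (q * nint ((q : ℝ) * α - β)) :=
        le_mul_of_one_le_left (h9.trans h10) hc1
      have h12 : (1 - R) * μ ^ (K + 1) ≤ 1 - R := mul_le_of_le_one_right (by linarith) hpow1
      linarith
  · right
    have hE : Dk α (m + 2) ≤ R * Dk α (m + 1) := by
      rw [show m + 2 = m + 1 + 1 from rfl, Dk_succ, mul_comm]
      exact mul_le_mul_of_nonneg_right (hR _) hD.le
    have hrem := le_one_sub_drem hirr h0 h1 hβ0 hβ1 hR hR1 hμ0 hμ1 hμ K (m + 1) (h (m + 1))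
    have h12 : (1 - R) * μ ^ (K + 1) ≤ 1 - R := mul_le_of_le_one_right (by linarith) hpow1
    have habs : Dk α (m + 1) * ((1 - R) * μ ^ (K + 1)) ≤ nint ((q : ℝ) * α - β) := by
      rw [hnint, hdiff]
      rcases le_or_le_of_small hirr h0 h1 m _ (p - P) hz (by omega) (by omega) with h3 | h3
      · refine le_trans ?_ (le_abs_self _)
        nlinarith
      · refine le_trans ?_ (neg_le_abs _)
        have := mul_nonneg hD.le hd.1
        nlinarith
    have hu : (prevDen α (m + 1) : ℝ) ≤ q := by exact_mod_cast hm2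
    have hone := one_le_mul_prevDen_mul_Dk hirr h0 h1 hc m
    have hX : 0 ≤ (1 - R) * μ ^ (K + 1) := mul_nonneg (by linarith) hpow0
    calc (1 - R) * μ ^ (K + 1)
        ≤ c * (prevDen α (m + 1) * Dk α (m + 1)) * ((1 - R) * μ ^ (K + 1)) :=
          le_mul_of_one_le_left hX hone
      _ = c * (prevDen α (m + 1) * (Dk α (m + 1) * ((1 - R) * μ ^ (K + 1)))) := by ring
      _ ≤ c * (q * nint ((q : ℝ) * α - β)) := by gcongr

/-- If the indices `m ≤ n < m'` isolate a short run of zeros around `n` then `λ_n` is not small. -/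
lemma pow_le_mul_lam (hirr : Irrational α) (h0 : 0 < α) (h1 : α < 1) {β : ℝ}
    (hβ0 : 0 < β) (hβ1 : β < 1) {μ c : ℝ} (hμ0 : 0 ≤ μ) (hμ1 : μ ≤ 1)
    (hμ : ∀ n, μ ≤ ncq α n) (hc1 : 1 ≤ c) (hc : ∀ n, Dk α n ≤ c * Dk α (n + 1))
    {m m' n J : ℕ} (hmn : m + 1 ≤ n) (hnm : n ≤ m') (hJ : m' + 1 ≤ m + 1 + J)
    (hm : db α β (m + 1) ≠ 0) (hm' : db α β (m' + 1) ≠ 0)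
    (hz : ∀ j, m + 1 < j → j ≤ m' → db α β j = 0) :
    μ ^ J ≤ c * lam α β n := by
  have hQ : (prevDen α (m + 1) : ℝ) ≤ Qn α β n := by
    have h2 := Qn_monotone hirr h0 h1 hβ0 hβ1 hmn
    rw [Qn_succ] at h2
    have h3 := Qn_nonneg hirr h0 h1 hβ0 hβ1 m
    have h4 := db_nonneg hirr h0 h1 hβ0 hβ1 m
    have h5 := nq_pos hirr h0 h1 m
    have h6 : nq α m ≤ db α β (m + 1) * nq α m := le_mul_of_one_le_left h5.le (by omega)
    have : prevDen α (m + 1) ≤ Qn α β n := by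
      simp only [prevDen]
      linarith
    exact_mod_cast this
  have hD : Dk α (m + 1) * μ ^ J ≤ Dk α n * drem α β n := by
    rw [← (Qn_eq_and_of_db_eq_zero hirr h0 h1 β hnm fun j hj hj' => hz j (by omega) hj').2]
    have h2 : (1 : ℝ) ≤ db α β (m' + 1) := by
      have := db_nonneg hirr h0 h1 hβ0 hβ1 m'
      exact_mod_cast (by omega : 1 ≤ db α β (m' + 1))
    have h3 := (drem_spec (α := α) β hβ0 hβ1 (m' + 1)).1
    have hmm : m + 1 + (m' - m) = m' + 1 := by omega
    have h4 := le_Dk_add hirr h0 h1 hμ0 hμ (m + 1) (m' - m)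
    rw [hmm] at h4
    have h5 : μ ^ J ≤ μ ^ (m' - m) := pow_le_pow_of_le_one hμ0 hμ1 (by omega)
    have h6 := Dk_pos hirr h0 h1 (m + 1)
    have h7 := Dk_pos hirr h0 h1 (m' + 1)
    calc Dk α (m + 1) * μ ^ J ≤ Dk α (m + 1) * μ ^ (m' - m) := by gcongr
      _ ≤ Dk α (m' + 1) := h4
      _ ≤ Dk α (m' + 1) * (db α β (m' + 1) + drem α β (m' + 1)) :=
        le_mul_of_one_le_right h7.le (by linarith)
      _ = Dk α m' * drem α β m' := by
        rw [drem_eq hirr h0 h1 β m', Dk_succ]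
        ring
  have hone := one_le_mul_prevDen_mul_Dk hirr h0 h1 hc m
  have hp : 0 ≤ μ ^ J := pow_nonneg hμ0 J
  have hu : (0 : ℝ) ≤ prevDen α (m + 1) := by
    exact_mod_cast (nq_pos hirr h0 h1 m).le
  calc μ ^ J ≤ c * (prevDen α (m + 1) * Dk α (m + 1)) * μ ^ J := le_mul_of_one_le_left hp hone
    _ = c * (prevDen α (m + 1) * (Dk α (m + 1) * μ ^ J)) := by ring
    _ ≤ c * (Qn α β n * (Dk α n * drem α β n)) :=
      mul_le_mul_of_nonneg_left (mul_le_mul hQ hD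
        (mul_nonneg (Dk_pos hirr h0 h1 (m + 1)).le hp) (hu.trans hQ)) (by linarith)
    _ = c * lam α β n := by rw [lam, mul_assoc]

lemma lam_le_of_db_eq_zero (hirr : Irrational α) (h0 : 0 < α) (h1 : α < 1) {β : ℝ}
    (hβ0 : 0 < β) (hβ1 : β < 1) {R : ℝ} (hR0 : 0 ≤ R) (hR : ∀ n, ncq α n ≤ R)
    (hR' : ∀ n, (prevDen α n : ℝ) ≤ R * prevDen α (n + 1)) (n r : ℕ)
    (hz : ∀ j, n < j → j ≤ n + r → db α β j = 0) :
    (1 - R ^ 2) * lam α β n ≤ R ^ r := by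
  have hQ0 : (0 : ℝ) ≤ Qn α β n := by exact_mod_cast Qn_nonneg hirr h0 h1 hβ0 hβ1 n
  have hQ : (Qn α β n : ℝ) ≤ prevDen α (n + 1) := by
    exact_mod_cast (Qn_lt_nq_and hirr h0 h1 hβ0 hβ1 n).1.le
  have hD := Dk_pos hirr h0 h1 n
  have hd := drem_spec (α := α) β hβ0 hβ1 (n + r)
  have hDr := Dk_add_le hirr h0 h1 hR n r
  have hlam : lam α β n ≤ prevDen α (n + 1) * Dk α n * R ^ r := by
    rw [lam, mul_assoc, ← (Qn_eq_and_of_db_eq_zero hirr h0 h1 β (Nat.le_add_right n r) hz).2]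
    have h3 : Dk α (n + r) * drem α β (n + r) ≤ Dk α n * R ^ r :=
      (mul_le_of_le_one_right (Dk_pos hirr h0 h1 _).le hd.2.le).trans hDr
    have h4 := mul_nonneg (Dk_pos hirr h0 h1 (n + r)).le hd.1
    rw [mul_assoc]
    exact mul_le_mul hQ h3 h4 (hQ0.trans hQ)
  have hdet := prevDen_mul_Dk_sub hirr h0 h1 n
  have hE : Dk α (n + 1) ≤ R * Dk α n := by
    rw [Dk_succ, mul_comm]
    exact mul_le_mul_of_nonneg_right (hR _) hD.le
  have hprod : (prevDen α n : ℝ) * Dk α (n + 1) ≤ R * prevDen α (n + 1) * (R * Dk α n) :=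
    mul_le_mul (hR' n) hE (Dk_pos hirr h0 h1 _).le (mul_nonneg hR0 (hQ0.trans hQ))
  have hkey : (1 - R ^ 2) * (prevDen α (n + 1) * Dk α n) ≤ 1 := by nlinarith
  rcases le_or_gt 0 (1 - R ^ 2) with h5 | h5
  · calc (1 - R ^ 2) * lam α β n ≤ (1 - R ^ 2) * (prevDen α (n + 1) * Dk α n * R ^ r) := by gcongr
      _ = (1 - R ^ 2) * (prevDen α (n + 1) * Dk α n) * R ^ r := by ring
      _ ≤ R ^ r := mul_le_of_le_one_left (pow_nonneg hR0 r) hkey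
  · have : 0 ≤ lam α β n :=
      mul_nonneg (mul_nonneg hQ0 hD.le) (drem_spec (α := α) β hβ0 hβ1 n).1
    have := pow_nonneg hR0 r
    nlinarith

lemma exists_db_ne_zero (hirr : Irrational α) (h0 : 0 < α) (h1 : α < 1) {β : ℝ}
    (hβ0 : 0 < β) (hβ1 : β < 1) {R : ℝ} (hR0 : 0 ≤ R) (hR1 : R < 1) (hR : ∀ n, ncq α n ≤ R)
    (hβform : ¬ ∃ n m : ℤ, β = n * α + m) (n : ℕ) : ∃ j, n < j ∧ db α β j ≠ 0 := by
  by_contra! hcon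
  obtain ⟨P, hP⟩ := exists_Qn_mul_sub hirr h0 h1 β n
  have hd := (drem_spec (α := α) β hβ0 hβ1 n).1
  have hle : ∀ r, Dk α n * drem α β n ≤ Dk α n * R ^ r := fun r => by
    rw [← (Qn_eq_and_of_db_eq_zero hirr h0 h1 β (Nat.le_add_right n r)
      fun j hj _ => hcon j hj).2]
    exact (mul_le_of_le_one_right (Dk_pos hirr h0 h1 _).le
      (drem_spec (α := α) β hβ0 hβ1 (n + r)).2.le).trans (Dk_add_le hirr h0 h1 hR n r)
  have hlim : Tendsto (fun r => Dk α n * R ^ r) atTop (nhds 0) := by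
    simpa using (tendsto_pow_atTop_nhds_zero_of_lt_one hR0 hR1).const_mul (Dk α n)
  have hzero : Dk α n * drem α β n ≤ 0 := ge_of_tendsto' hlim hle
  have hzero' : 0 ≤ Dk α n * drem α β n := mul_nonneg (Dk_pos hirr h0 h1 n).le hd
  refine hβform ⟨Qn α β n, -P, ?_⟩
  push_cast
  linarith

lemma tendsto_Qn (hirr : Irrational α) (h0 : 0 < α) (h1 : α < 1) {β : ℝ}
    (hβ0 : 0 < β) (hβ1 : β < 1) {R : ℝ} (hR0 : 0 ≤ R) (hR1 : R < 1) (hR : ∀ n, ncq α n ≤ R)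
    (hβform : ¬ ∃ n m : ℤ, β = n * α + m) : Tendsto (Qn α β) atTop atTop := by
  have hmono := Qn_monotone hirr h0 h1 hβ0 hβ1
  have hstep : ∀ B : ℕ, ∃ n, (B : ℤ) ≤ Qn α β n := fun B => by
    induction B with
    | zero => exact ⟨0, Qn_nonneg hirr h0 h1 hβ0 hβ1 0⟩
    | succ B ih =>
      obtain ⟨n, hn⟩ := ih
      obtain ⟨j, hj, hne⟩ := exists_db_ne_zero hirr h0 h1 hβ0 hβ1 hR0 hR1 hR hβform n
      obtain ⟨j, rfl⟩ : ∃ i, j = i + 1 := ⟨j - 1, by omega⟩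
      refine ⟨j + 1, ?_⟩
      have h2 := hmono (by omega : n ≤ j)
      have h3 := db_nonneg hirr h0 h1 hβ0 hβ1 j
      have h4 := mul_pos (by omega : 0 < db α β (j + 1)) (nq_pos hirr h0 h1 j)
      rw [Qn_succ]
      push_cast
      omega
  refine tendsto_atTop_atTop_of_monotone hmono fun B => ?_
  obtain ⟨n, hn⟩ := hstep B.toNat
  exact ⟨n, (Int.self_le_toNat B).trans hn⟩

/-- Beyond the first marked index, every `λ_n` either equals a marked one or is not small. -/
lemma exists_lam_eq_or_pow_le (hirr : Irrational α) (h0 : 0 < α) (h1 : α < 1) {β : ℝ}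
    (hβ0 : 0 < β) (hβ1 : β < 1) {μ c : ℝ} (hμ0 : 0 ≤ μ) (hμ1 : μ ≤ 1)
    (hμ : ∀ n, μ ≤ ncq α n) (hc1 : 1 ≤ c) (hc : ∀ n, Dk α n ≤ c * Dk α (n + 1))
    {r J : ℕ} {k : ℕ → ℕ} (hkmono : StrictMono k)
    (hzeros : ∀ i j, k i < j → j ≤ k i + r → db α β j = 0)
    (hnozeroblock : ∀ i j, k i + r < j → j + J ≤ k (i + 1) + 1 →
      ∃ l, j ≤ l ∧ l < j + J ∧ db α β l ≠ 0) {n : ℕ} (hn : k 0 ≤ n) :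
    (∃ i, Qn α β (k i) = Qn α β n ∧ lam α β (k i) = lam α β n) ∨ μ ^ J ≤ c * lam α β n := by
  classical
  obtain ⟨i, hi, hi'⟩ : ∃ i, k i ≤ n ∧ n < k (i + 1) := by
    have hex : ∃ i, n < k i := ⟨n + 1, hkmono.id_le (n + 1)⟩
    have hf := Nat.find_spec hex
    have hmin := fun j => Nat.find_min (m := j) hex
    rcases hn' : Nat.find hex with _ | i
    · rw [hn'] at hf
      omega
    · rw [hn'] at hf
      exact ⟨i, not_lt.mp (hmin i (by omega)), hf⟩
  by_cases hA : ∀ j, k i < j → j ≤ n → db α β j = 0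
  · left
    have := Qn_eq_and_of_db_eq_zero hirr h0 h1 β hi hA
    exact ⟨i, this.1.symm, by rw [lam, lam, this.1, mul_assoc, mul_assoc, this.2]⟩
  by_cases hB : ∀ j, n < j → j ≤ k (i + 1) → db α β j = 0
  · left
    have := Qn_eq_and_of_db_eq_zero hirr h0 h1 β hi'.le hB
    exact ⟨i + 1, this.1, by rw [lam, lam, this.1, mul_assoc, mul_assoc, this.2]⟩
  right
  push Not at hA hB
  obtain ⟨m, ⟨hm1, hm2, hm3⟩, hmax⟩ : ∃ m, (k i < m ∧ m ≤ n ∧ db α β m ≠ 0) ∧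
      ∀ j, m < j → j ≤ n → db α β j = 0 := by
    obtain ⟨j, hj⟩ := hA
    have hspec := Nat.findGreatest_spec (P := fun m => k i < m ∧ m ≤ n ∧ db α β m ≠ 0) hj.2.1 hj
    refine ⟨_, hspec, fun l hl hl' => ?_⟩
    have := Nat.findGreatest_is_greatest hl hl'
    by_contra hne
    exact this ⟨hspec.1.trans hl, hl', hne⟩
  obtain ⟨m', ⟨hm1', hm2', hm3'⟩, hmin⟩ : ∃ m', (n < m' ∧ m' ≤ k (i + 1) ∧ db α β m' ≠ 0) ∧
      ∀ j, n < j → j < m' → db α β j = 0 := by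
    refine ⟨_, Nat.find_spec hB, fun l hl hl' => ?_⟩
    have h3 := Nat.find_min hB hl'
    by_contra hne
    exact h3 ⟨hl, hl'.le.trans (Nat.find_spec hB).2.1, hne⟩
  have hz : ∀ j, m < j → j < m' → db α β j = 0 := fun j hj hj' => by
    rcases Nat.lt_or_ge n j with h3 | h3
    · exact hmin j h3 hj'
    · exact hmax j hj h3
  have hmr : k i + r < m := by
    by_contra! hcon
    exact hm3 (hzeros i m hm1 hcon)
  have hJ : m' ≤ m + J := by
    by_contra! hcon
    obtain ⟨l, hl1, hl2, hl3⟩ := hnozeroblock i (m + 1) (by omega) (by omega)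
    exact hl3 (hz l (by omega) (by omega))
  obtain ⟨m, rfl⟩ : ∃ t, m = t + 1 := ⟨m - 1, by omega⟩
  obtain ⟨m', rfl⟩ : ∃ t, m' = t + 1 := ⟨m' - 1, by omega⟩
  exact pow_le_mul_lam hirr h0 h1 hβ0 hβ1 hμ0 hμ1 hμ hc1 hc hm2 (by omega) hJ hm3 hm3'
    fun j hj hj' => hz j hj (by omega)

end Bounds

/-- Under the bounded-partial-quotient hypotheses (`a_i ≤ M`, no block of
`N` consecutive `2`'s), with `R = N/(N+1)`, `L` the least positive integer with
`R^L ≤ (1−R)(1−R²)/(M^N(M²−1))`, positive integers `r ≥ sL`, and a strictly increasing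
sequence `k` of positive integers with `k(i+1) > k(i) + r`: if `0 < β < 1` is not of the
form `nα + m`, and its Davenport coefficients satisfy the three block conditions, then
`M₊(α,β) = liminf_{i→∞} λ_{k(i)}(β)`. -/
theorem stmt17 (α : ℝ) (hirr : Irrational α) (h0 : 0 < α) (h1 : α < 1)
    (M N : ℕ) (hM0 : 0 < M) (hN0 : 1 ≤ N)
    (hM : ∀ i : ℕ, 1 ≤ i → npq α i ≤ (M : ℤ))
    (hN : ¬ ∃ i : ℕ, 1 ≤ i ∧ ∀ k : ℕ, i ≤ k → k < i + N → npq α k = 2)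
    (R : ℝ) (hR : R = (N : ℝ) / ((N : ℝ) + 1))
    (L : ℕ)
    (hL : IsLeast {l : ℕ | 0 < l ∧
      R ^ l ≤ (1 - R) * (1 - R ^ 2) / ((M : ℝ) ^ N * ((M : ℝ) ^ 2 - 1))} L)
    (r s : ℕ) (hr : 0 < r) (hs : 0 < s) (hrs : s * L ≤ r)
    (k : ℕ → ℕ) (hkpos : ∀ i, 0 < k i) (hkmono : StrictMono k)
    (hkgap : ∀ i : ℕ, k i + r < k (i + 1))
    (β : ℝ) (hβ0 : 0 < β) (hβ1 : β < 1)
    (hβform : ¬ ∃ n m : ℤ, β = n * α + m)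
    (hzeros : ∀ i j : ℕ, k i < j → j ≤ k i + r → db α β j = 0)
    (hnozeroblock : ∀ i j : ℕ, k i + r < j → j + N + s ≤ k (i + 1) + 1 →
      ∃ l : ℕ, j ≤ l ∧ l < j + N + s ∧ db α β l ≠ 0)
    (hnoshortblock : ∀ j : ℕ, 1 ≤ j →
      ¬ (db α β j = npq α j - 1 ∧
          ∀ l : ℕ, j < l → l < j + N + s → db α β l = npq α l - 2)) :
    Mplus α β = Filter.liminf (fun i : ℕ => lam α β (k i)) Filter.atTop := by
  have hN' : (0 : ℝ) < (N : ℝ) + 1 := by positivity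
  have hRN : ((N : ℝ) + 1) * R = N := by rw [hR]; field_simp
  have hN1 : (1 : ℝ) ≤ N := by exact_mod_cast hN0
  have hR0 : 0 < R := by rw [hR]; positivity
  have hR1 : R < 1 := by rw [hR, div_lt_one hN']; linarith
  have hM2 : (2 : ℝ) ≤ M := by
    have h2 := two_le_npq hirr h0 h1 0
    exact_mod_cast h2.trans (hM 1 le_rfl)
  have hMpos : (0 : ℝ) < M := by linarith
  have hncq : ∀ n, ncq α n ≤ R := fun n => by
    by_contra! hcon
    refine hN ⟨n + 1, by omega, fun l hl hl' => ?_⟩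
    have := npq_eq_two_of_lt_ncq hirr h0 h1 N n (by nlinarith) (l - (n + 1)) (by omega)
    rwa [show n + 1 + (l - (n + 1)) = l by omega] at this
  have hden : ∀ n, (prevDen α n : ℝ) ≤ R * prevDen α (n + 1) := fun n => by
    have h2 : ((N : ℤ) + 1) * prevDen α n ≤ N * prevDen α (n + 1) := by
      by_contra! hcon
      obtain ⟨hle, h3⟩ := npq_eq_two_of_lt_prevDen hirr h0 h1 N n hcon
      exact hN ⟨n + 1 - N, by omega, fun l hl hl' => h3 l (by omega) (by omega)⟩
    have h3 : ((N : ℝ) + 1) * prevDen α n ≤ N * prevDen α (n + 1) := by exact_mod_cast h2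
    refine le_of_mul_le_mul_left ?_ hN'
    rwa [← mul_assoc, hRN]
  obtain ⟨μ, hμdef⟩ : ∃ μ : ℝ, μ = (M : ℝ)⁻¹ := ⟨_, rfl⟩
  have hμM : μ * M = 1 := by rw [hμdef]; field_simp
  have hμ0 : 0 < μ := by rw [hμdef]; positivity
  have hμ1 : μ ≤ 1 := by nlinarith
  have hμ : ∀ n, μ ≤ ncq α n := fun n => by
    obtain ⟨-, hp, -⟩ := ncq_spec hirr h0 h1 n
    have hp' := (ncq_spec hirr h0 h1 (n + 1)).2.1
    have h2 := inv_ncq α n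
    have h3 : (npq α (n + 1) : ℝ) ≤ M := by exact_mod_cast hM (n + 1) (by omega)
    rw [hμdef]
    exact inv_le_of_inv_le₀ hp (by linarith)
  obtain ⟨c, hcdef⟩ : ∃ c : ℝ, c = M - μ := ⟨_, rfl⟩
  have hc1 : 1 ≤ c := by linarith
  have hc0 : 0 < c := by linarith
  have hc : ∀ n, Dk α n ≤ c * Dk α (n + 1) := fun n => by
    have h2 := Dk_add_two hirr h0 h1 n
    have h3 : (npq α (n + 1) : ℝ) ≤ M := by exact_mod_cast hM (n + 1) (by omega)
    have h4 := Dk_pos hirr h0 h1 (n + 1)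
    have h5 : μ * Dk α (n + 1) ≤ Dk α (n + 2) := by
      rw [show n + 2 = n + 1 + 1 from rfl, Dk_succ α (n + 1), mul_comm]
      exact mul_le_mul_of_nonneg_left (hμ _) h4.le
    rw [hcdef]
    nlinarith
  obtain ⟨T, hT⟩ : ∃ T : ℝ, T = (1 - R) * μ ^ (N + s) := ⟨_, rfl⟩
  have hlam0 : ∀ n, 0 ≤ lam α β n := fun n =>
    mul_nonneg (mul_nonneg (by exact_mod_cast Qn_nonneg hirr h0 h1 hβ0 hβ1 n)
      (Dk_pos hirr h0 h1 n).le) (drem_spec β hβ0 hβ1 n).1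
  have hlamT : ∀ i, c * lam α β (k i) ≤ T := fun i => by
    have h2 := lam_le_of_db_eq_zero hirr h0 h1 hβ0 hβ1 hR0.le hncq hden (k i) r (hzeros i)
    have hRR : 0 < 1 - R ^ 2 := by nlinarith
    have hRR1 : (1 - R) * (1 - R ^ 2) ≤ 1 := by nlinarith [sq_nonneg R]
    obtain ⟨X, hX⟩ : ∃ X, X = (1 - R) * (1 - R ^ 2) / ((M : ℝ) ^ N * ((M : ℝ) ^ 2 - 1)) :=
      ⟨_, rfl⟩
    have hXc : c * X = (1 - R) * (1 - R ^ 2) * μ ^ (N + 1) := by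
      have h3 : (M : ℝ) ^ 2 - 1 = M * c := by
        rw [hcdef]
        linear_combination hμM
      have h4 : μ ^ (N + 1) * (M : ℝ) ^ (N + 1) = 1 := by rw [← mul_pow, hμM, one_pow]
      rw [hX, h3, mul_div_assoc', div_eq_iff (by positivity)]
      linear_combination (-(1 - R) * (1 - R ^ 2) * c) * h4
    have hX0 : 0 ≤ X := by
      have : 0 ≤ c * X := by
        rw [hXc]
        exact mul_nonneg (mul_nonneg (by linarith) hRR.le) (by positivity)
      exact nonneg_of_mul_nonneg_right this hc0
    have hXμ : X ≤ μ := by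
      have h3 : X ≤ c * X := le_mul_of_one_le_left hX0 hc1
      have h4 : (1 - R) * (1 - R ^ 2) * μ ^ (N + 1) ≤ μ ^ (N + 1) :=
        mul_le_of_le_one_left (by positivity) hRR1
      have h5 : μ ^ (N + 1) ≤ μ := pow_le_of_le_one hμ0.le hμ1 (by omega)
      linarith
    have hRr : R ^ r ≤ X * μ ^ (s - 1) := by
      calc R ^ r ≤ R ^ (s * L) := pow_le_pow_of_le_one hR0.le hR1.le hrs
        _ = (R ^ L) ^ s := by rw [mul_comm, pow_mul]
        _ ≤ X ^ s := pow_le_pow_left₀ (by positivity) (hX ▸ hL.1.2) s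
        _ = X * X ^ (s - 1) := (mul_pow_sub_one (by omega) X).symm
        _ ≤ X * μ ^ (s - 1) := by gcongr
    have h3 : (1 - R ^ 2) * (c * lam α β (k i)) ≤ (1 - R ^ 2) * T := by
      calc (1 - R ^ 2) * (c * lam α β (k i)) = c * ((1 - R ^ 2) * lam α β (k i)) := by ring
        _ ≤ c * (X * μ ^ (s - 1)) :=
          mul_le_mul_of_nonneg_left (h2.trans hRr) hc0.le
        _ = (c * X) * μ ^ (s - 1) := by ring
        _ = (1 - R ^ 2) * T := by
          rw [hXc, hT, show N + s = N + 1 + (s - 1) by omega, pow_add μ (N + 1)]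
          ring
    exact le_of_mul_le_mul_left h3 hRR
  have hQtop := (tendsto_Qn hirr h0 h1 hβ0 hβ1 hR0.le hR1 hncq hβform).comp hkmono.tendsto_atTop
  have hmono := Qn_monotone hirr h0 h1 hβ0 hβ1
  obtain ⟨f, hf⟩ : ∃ f : ℕ → ℝ, f = fun q : ℕ => (q : ℝ) * nint (q * α - β) := ⟨_, rfl⟩
  have hf0 : ∀ q, 0 ≤ f q := fun q => by
    rw [hf]
    exact mul_nonneg q.cast_nonneg (abs_nonneg _)
  have hfQ : ∀ n, f (Qn α β n).toNat ≤ lam α β n := fun n => by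
    obtain ⟨P, hP⟩ := exists_Qn_mul_sub hirr h0 h1 β n
    have hQ0 := Qn_nonneg hirr h0 h1 hβ0 hβ1 n
    have hcast : (((Qn α β n).toNat : ℕ) : ℝ) = (Qn α β n : ℝ) := by
      exact_mod_cast Int.toNat_of_nonneg hQ0
    have h2 : nint ((Qn α β n : ℝ) * α - β) ≤ Dk α n * drem α β n := by
      refine (round_le _ P).trans (le_of_eq ?_)
      rw [show (Qn α β n : ℝ) * α - β - P = -(Dk α n * drem α β n) by linarith, abs_neg]
      exact abs_of_nonneg (mul_nonneg (Dk_pos hirr h0 h1 n).le (drem_spec β hβ0 hβ1 n).1)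
    rw [hf, lam, mul_assoc]
    simp only [hcast]
    exact mul_le_mul_of_nonneg_left h2 (by exact_mod_cast hQ0)
  have hlamf : ∀ q : ℕ, Qn α β (k 0) < q →
      (∃ i, Qn α β (k i) = q ∧ lam α β (k i) ≤ f q) ∨ T ≤ c * f q := fun q hq => by
    have hq0 : 0 < q := by
      have := Qn_nonneg hirr h0 h1 hβ0 hβ1 (k 0)
      omega
    rw [hf]
    rcases exists_lam_le_or_le hirr h0 h1 hβ0 hβ1 hncq hR1.le hμ0.le hμ1 hμ hc1 hc (N + s - 1)
      (fun n => by
        rw [show N + s - 1 + 1 = N + s by omega, ← add_assoc]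
        exact hnoshortblock (n + 1) (by omega)) q hq0 with ⟨n, hn, hle⟩ | hle
    · have hkn : k 0 ≤ n := by
        by_contra! hcon
        have := hmono hcon.le
        omega
      rcases exists_lam_eq_or_pow_le hirr h0 h1 hβ0 hβ1 hμ0.le hμ1 hμ hc1 hc (J := N + s)
        hkmono hzeros (by simpa only [← add_assoc] using hnozeroblock) hkn
        with ⟨i, hi, hi'⟩ | hpow
      · exact Or.inl ⟨i, hi.trans hn, hi'.trans_le hle⟩
      · right
        have h2 : T ≤ μ ^ (N + s) := by
          rw [hT]
          exact mul_le_of_le_one_left (by positivity) (by linarith)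
        exact h2.trans (hpow.trans (mul_le_mul_of_nonneg_left hle hc0.le))
    · right
      rwa [show N + s - 1 + 1 = N + s by omega, ← hT] at hle
  have htoNat : Tendsto (fun i => (Qn α β (k i)).toNat) atTop atTop :=
    tendsto_atTop.mpr fun B => (tendsto_atTop.mp hQtop (B : ℤ)).mono fun i hi => by
      simp only [Function.comp_apply] at hi
      omega
  have hlamT' : ∀ i, lam α β (k i) ≤ T := fun i =>
    (le_mul_of_one_le_left (hlam0 _) hc1).trans (hlamT i)
  have hbddf : IsBoundedUnder (· ≥ ·) atTop f := isBoundedUnder_of ⟨0, hf0⟩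
  have hcobf : IsCoboundedUnder (· ≥ ·) atTop f := by
    refine IsCoboundedUnder.of_frequently_le (a := T) ?_
    refine htoNat.frequently (Frequently.of_forall fun i => ?_)
    exact (hfQ _).trans (hlamT' i)
  have hbddl : IsBoundedUnder (· ≥ ·) atTop fun i => lam α β (k i) :=
    isBoundedUnder_of ⟨0, fun i => hlam0 _⟩
  have hcobl : IsCoboundedUnder (· ≥ ·) atTop fun i => lam α β (k i) :=
    IsCoboundedUnder.of_frequently_le (a := T) (Frequently.of_forall hlamT')
  rw [Mplus, ← hf]
  apply le_antisymm
  · refine le_of_forall_lt fun x hx => ?_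
    obtain ⟨y, hxy, hy⟩ := exists_between hx
    refine hxy.trans_le (le_liminf_of_le hcobl ?_)
    exact (htoNat.eventually (eventually_lt_of_lt_liminf hy hbddf)).mono fun i hi =>
      hi.le.trans (hfQ _)
  · refine le_of_forall_lt fun x hx => ?_
    obtain ⟨y, hxy, hy⟩ := exists_between hx
    refine hxy.trans_le (le_liminf_of_le hcobf ?_)
    obtain ⟨i₀, hi₀⟩ := eventually_atTop.mp (eventually_lt_of_lt_liminf hy hbddl)
    filter_upwards [eventually_gt_atTop (Qn α β (k 0)).toNat,
      eventually_gt_atTop (Qn α β (k i₀)).toNat] with q hq hq'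
    rcases hlamf q (by omega) with ⟨i, hi, hle⟩ | hle
    · refine (hi₀ i ?_).le.trans hle
      by_contra! hcon
      have := hmono (hkmono.monotone hcon.le)
      omega
    · have h2 := (hlamT i₀).trans hle
      exact (hi₀ i₀ le_rfl).le.trans (le_of_mul_le_mul_left h2 hc0)
end

section
/- Let α be irrational with 0 < α < 1 whose negative continued fraction partial quotients satisfy a_i ≤ M for all i and contain no block of N consecutive terms equal to 2, and let s ≥ N be an integer. Let c = (c₁, …, c_n) with 0 ≤ c_k ≤ a_k − 1 be such that F(c) ≠ ∅, let t be the largest integer with 0 ≤ t ≤ n such that c_{n−t+1} = ⋯ = c_n = 0, and let u be the unique integer with 0 ≤ u ≤ n such that (c_{n−u+1}, …, c_n) = (a_{n−u+1} − 1, a_{n−u+2} − 2, …, a_n − 2) (with u = 0 if no such suffix exists). Then: C̲(c) < S(c) + D_{n+s} if t = 0, and C̲(c) < S(c) + D_{n+1} + D_{n+s} if t > 0; moreover C̄(c) > S(c) + D_n − D_{n+s−N} if u = 0, and C̄(c) > S(c) + D_{n+N+1} if u > 0. -/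
open Filter Finset

/-- `F(α,s)`: the set of `β ∈ [0,1)` whose Davenport coefficients contain no block of
`s+1` consecutive zeros and no block `(b_i, …, b_{i+s}) = (a_i−1, a_{i+1}−2, …, a_{i+s}−2)`. -/
def Fset (α : ℝ) (s : ℕ) : Set ℝ :=
  {β : ℝ | 0 ≤ β ∧ β < 1 ∧ ∀ i : ℕ, 1 ≤ i →
    (∃ l : ℕ, i ≤ l ∧ l ≤ i + s ∧ db α β l ≠ 0) ∧
    ¬ (db α β i = npq α i - 1 ∧
        ∀ l : ℕ, i < l → l ≤ i + s → db α β l = npq α l - 2)}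

/-- `S(c) = Σ_{k=1}^n c_k D_k`. -/
noncomputable def Sval (α : ℝ) (n : ℕ) (c : ℕ → ℤ) : ℝ :=
  ∑ k ∈ Finset.Icc 1 n, (c k : ℝ) * Dk α k

/-- `F(c)`: elements of `F(α,s)` whose Davenport coefficients begin with `c₁, …, c_n`. -/
def Fcyl (α : ℝ) (s n : ℕ) (c : ℕ → ℤ) : Set ℝ :=
  {β ∈ Fset α s | ∀ k : ℕ, 1 ≤ k → k ≤ n → db α β k = c k}

namespace Davenport

/-! ### Digit words and their state -/

/-- Length of the longest suffix `(a_i - 1, a_{i+1} - 2, …, a_k - 2)` of the word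
`(d_1, …, d_k)` (and `0` if there is none). -/
def blockLength (a d : ℕ → ℤ) : ℕ → ℕ
  | 0 => 0
  | k + 1 =>
    if blockLength a d k = 0 then (if d (k + 1) = a (k + 1) - 1 then 1 else 0)
    else if d (k + 1) = a (k + 1) - 2 then blockLength a d k + 1 else 0

/-- Number of trailing zeros of the word `(d_1, …, d_k)`. -/
def zeroLength (d : ℕ → ℤ) : ℕ → ℕ
  | 0 => 0
  | k + 1 => if d (k + 1) = 0 then zeroLength d k + 1 else 0

/-- The digit `d_{k+1}` is allowed after the word `(d_1, …, d_k)`. -/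
def Legal (a d : ℕ → ℤ) (k : ℕ) : Prop :=
  0 ≤ d (k + 1) ∧ d (k + 1) ≤ a (k + 1) - 1 ∧
    (blockLength a d k ≠ 0 → d (k + 1) ≤ a (k + 1) - 2)

/-- The `j` partial quotients after position `k` all equal `2`. -/
def Twos (a : ℕ → ℤ) (k j : ℕ) : Prop := ∀ i, k < i → i ≤ k + j → a i = 2

/-- A word of length `k` with block length `u` and `z` trailing zeros can be continued. -/
def Alive (a : ℕ → ℤ) (s N k u z : ℕ) : Prop :=
  (u = 0 ∧ z ≤ s) ∨ (u ≠ 0 ∧ ∀ j, Twos a k j → u + j ≤ s ∧ z + j < N)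

/-- The first `m` digits of `d` are legal and every prefix can be continued. -/
def Viable (a : ℕ → ℤ) (s N : ℕ) (d : ℕ → ℤ) (m : ℕ) : Prop :=
  (∀ k < m, Legal a d k) ∧ ∀ k ≤ m, Alive a s N k (blockLength a d k) (zeroLength d k)

variable {a d e : ℕ → ℤ} {s N m k : ℕ}

lemma blockLength_succ (a d : ℕ → ℤ) (k : ℕ) :
    blockLength a d (k + 1) =
      if blockLength a d k = 0 then (if d (k + 1) = a (k + 1) - 1 then 1 else 0)
      else if d (k + 1) = a (k + 1) - 2 then blockLength a d k + 1 else 0 := rfl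

lemma zeroLength_succ (d : ℕ → ℤ) (k : ℕ) :
    zeroLength d (k + 1) = if d (k + 1) = 0 then zeroLength d k + 1 else 0 := rfl

lemma blockLength_congr (h : ∀ i, 1 ≤ i → i ≤ k → e i = d i) :
    blockLength a e k = blockLength a d k := by
  induction k with
  | zero => rfl
  | succ k ih =>
    simp only [blockLength, ih fun i h1 h2 => h i h1 (by omega), h (k + 1) (by omega) le_rfl]

lemma zeroLength_congr (h : ∀ i, 1 ≤ i → i ≤ k → e i = d i) :
    zeroLength e k = zeroLength d k := by
  induction k with
  | zero => rfl
  | succ k ih =>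
    simp only [zeroLength, ih fun i h1 h2 => h i h1 (by omega), h (k + 1) (by omega) le_rfl]

lemma Viable.congr (hv : Viable a s N d m) (h : ∀ i, 1 ≤ i → i ≤ m → e i = d i) :
    Viable a s N e m := by
  refine ⟨fun k hk => ?_, fun k hk => ?_⟩
  · have := hv.1 k hk
    simpa only [Legal, blockLength_congr (a := a) fun i h1 h2 => h i h1 (by omega : i ≤ m),
      blockLength_congr (a := a) (k := k) fun i h1 h2 => h i h1 (by omega : i ≤ m),
      h (k + 1) (by omega) (by omega)] using this
  · have := hv.2 k hk
    rwa [blockLength_congr (a := a) (k := k) fun i h1 h2 => h i h1 (by omega : i ≤ m),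
      zeroLength_congr (k := k) fun i h1 h2 => h i h1 (by omega : i ≤ m)]

lemma Viable.mono (hv : Viable a s N d m) (hk : k ≤ m) : Viable a s N d k :=
  ⟨fun i hi => hv.1 i (by omega), fun i hi => hv.2 i (by omega)⟩

lemma Viable.succ (hv : Viable a s N d m) (hl : Legal a d m)
    (ha : Alive a s N (m + 1) (blockLength a d (m + 1)) (zeroLength d (m + 1))) :
    Viable a s N d (m + 1) := by
  refine ⟨fun k hk => ?_, fun k hk => ?_⟩
  · rcases Nat.lt_succ_iff_lt_or_eq.mp hk with h | rfl
    exacts [hv.1 k h, hl]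
  · rcases Nat.le_succ_iff.mp hk with h | rfl
    exacts [hv.2 k h, ha]

lemma Twos.cons {j : ℕ} (h : Twos a (k + 1) j) (h2 : a (k + 1) = 2) : Twos a k (j + 1) := by
  intro i hi hi'
  rcases Nat.eq_or_lt_of_le (Nat.succ_le_of_lt hi) with h' | h'
  · rwa [← h']
  · exact h i h' (by omega)

lemma twos_zero : Twos a k 0 := fun i h h' => by omega

lemma Viable.succ_zero (ha : ∀ i, 1 ≤ i → 2 ≤ a i) (hs : N ≤ s) (hv : Viable a s N d m)
    (hd : d (m + 1) = 0) (hz : blockLength a d m = 0 → zeroLength d m + 1 ≤ s) :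
    Viable a s N d (m + 1) := by
  have h2 := ha (m + 1) (by omega)
  refine hv.succ ⟨by omega, by omega, fun _ => by omega⟩ ?_
  rcases hv.2 m le_rfl with ⟨hu, -⟩ | ⟨hu, hj⟩
  · left
    simp only [blockLength, zeroLength, hu, hd, if_true]
    rw [if_neg (by omega)]
    exact ⟨rfl, hz hu⟩
  · simp only [blockLength, zeroLength, hu, hd, if_true, if_false]
    split_ifs with h
    · right
      refine ⟨by omega, fun j hj' => ?_⟩
      have := hj (j + 1) (hj'.cons (by omega))
      omega
    · left
      have := hj 0 twos_zero
      omega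

lemma Viable.succ_pos (hN : ∀ k j, Twos a k j → j < N) (hs : N ≤ s) (hv : Viable a s N d m)
    (hu : blockLength a d m = 0) (hd : 1 ≤ d (m + 1)) (hd' : d (m + 1) ≤ a (m + 1) - 1) :
    Viable a s N d (m + 1) := by
  refine hv.succ ⟨by omega, hd', fun h => absurd hu h⟩ ?_
  have hz : zeroLength d (m + 1) = 0 := by simp only [zeroLength]; rw [if_neg (by omega)]
  rw [hz]
  simp only [blockLength, hu, if_true]
  split_ifs with h
  · right
    refine ⟨by omega, fun j hj => ?_⟩
    have := hN _ _ hj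
    omega
  · left
    omega

lemma Viable.succ_block (ha : ∀ i, 1 ≤ i → 2 ≤ a i) (hN : ∀ k j, Twos a k j → j < N)
    (hv : Viable a s N d m) (hu : blockLength a d m ≠ 0) (hd : d (m + 1) = a (m + 1) - 2)
    (hb : blockLength a d m + 1 + N ≤ s) : Viable a s N d (m + 1) := by
  have h2 := ha (m + 1) (by omega)
  refine hv.succ ⟨by omega, by omega, fun _ => by omega⟩ ?_
  rcases hv.2 m le_rfl with ⟨hu', -⟩ | ⟨-, hj⟩
  · exact absurd hu' hu
  right
  simp only [blockLength, zeroLength, hu, if_false]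
  rw [if_pos hd]
  refine ⟨by omega, fun j hj' => ?_⟩
  have hjN := hN _ _ hj'
  split_ifs with h
  · have := hj (j + 1) (hj'.cons (by omega))
    omega
  · omega

/-- State of the canonical continuation of the first `m` digits of `d`, which appends `1` when
no block is running and `0` otherwise. -/
def contLength (a d : ℕ → ℤ) (m : ℕ) : ℕ → ℕ
  | 0 => 0
  | k + 1 =>
    let x : ℤ := if k < m then d (k + 1) else if contLength a d m k = 0 then 1 else 0
    if contLength a d m k = 0 then (if x = a (k + 1) - 1 then 1 else 0)
    else if x = a (k + 1) - 2 then contLength a d m k + 1 else 0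

/-- Digits of the canonical continuation. -/
def cont (a d : ℕ → ℤ) (m k : ℕ) : ℤ :=
  if k - 1 < m then d k else if contLength a d m (k - 1) = 0 then 1 else 0

lemma blockLength_cont : blockLength a (cont a d m) k = contLength a d m k := by
  induction k with
  | zero => rfl
  | succ k ih => simp only [blockLength, contLength, ih, cont, Nat.add_sub_cancel]

lemma Viable.exists_extension (ha : ∀ i, 1 ≤ i → 2 ≤ a i) (hN : ∀ k j, Twos a k j → j < N)
    (hs : N ≤ s) (hv : Viable a s N d m) :
    ∃ e : ℕ → ℤ, (∀ i, 1 ≤ i → i ≤ m → e i = d i) ∧ ∀ k, Viable a s N e k := by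
  have hcongr : ∀ i, 1 ≤ i → i ≤ m → cont a d m i = d i := fun i h1 h2 =>
    if_pos (by omega)
  have hm : Viable a s N (cont a d m) m := hv.congr hcongr
  refine ⟨cont a d m, hcongr, fun k => ?_⟩
  rcases le_total k m with h | h
  · exact hm.mono h
  · induction k, h using Nat.le_induction with
    | base => exact hm
    | succ k hk ih =>
      have h2 := ha (k + 1) (by omega)
      have hdig : cont a d m (k + 1) = if blockLength a (cont a d m) k = 0 then 1 else 0 := by
        rw [blockLength_cont, cont, Nat.add_sub_cancel, if_neg (by omega)]
      by_cases hu : blockLength a (cont a d m) k = 0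
      · rw [if_pos hu] at hdig
        exact ih.succ_pos hN hs hu (by omega) (by omega)
      · rw [if_neg hu] at hdig
        exact ih.succ_zero ha hs hdig fun h => absurd h hu

lemma Viable.succ_iterate_zero (ha : ∀ i, 1 ≤ i → 2 ≤ a i) (hs : N ≤ s)
    (hv : Viable a s N d m) (l : ℕ) (hl : zeroLength d m + l ≤ s)
    (hd : ∀ i, m < i → i ≤ m + l → d i = 0) :
    Viable a s N d (m + l) ∧ zeroLength d (m + l) = zeroLength d m + l := by
  induction l with
  | zero => exact ⟨hv, rfl⟩
  | succ l ih =>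
    obtain ⟨h1, h2⟩ := ih (by omega) fun i hi hi' => hd i hi (by omega)
    have h0 : d (m + l + 1) = 0 := hd _ (by omega) (by omega)
    rw [← add_assoc m l 1]
    refine ⟨h1.succ_zero ha hs h0 fun _ => by omega, ?_⟩
    rw [zeroLength_succ, if_pos h0, h2, add_assoc]

lemma blockLength_spec (hu : blockLength a d k ≠ 0) :
    blockLength a d k ≤ k ∧
      d (k - blockLength a d k + 1) = a (k - blockLength a d k + 1) - 1 ∧
      ∀ l, k - blockLength a d k + 1 < l → l ≤ k → d l = a l - 2 := by
  induction k with
  | zero => exact absurd rfl hu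
  | succ k ih =>
    by_cases h0 : blockLength a d k = 0
    · by_cases h1 : d (k + 1) = a (k + 1) - 1
      · have : blockLength a d (k + 1) = 1 := by
          rw [blockLength_succ, if_pos h0, if_pos h1]
        rw [this]
        exact ⟨by omega, h1, fun l _ _ => by omega⟩
      · exact absurd (by simp only [blockLength, h0, if_true]; rw [if_neg h1]) hu
    · by_cases h1 : d (k + 1) = a (k + 1) - 2
      · have : blockLength a d (k + 1) = blockLength a d k + 1 := by
          simp only [blockLength, h0, if_false]; rw [if_pos h1]
        rw [this, Nat.add_sub_add_right]
        obtain ⟨h3, h4, h5⟩ := ih h0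
        refine ⟨by omega, h4, fun l hl hl' => ?_⟩
        rcases Nat.le_succ_iff.mp hl' with h | rfl
        exacts [h5 l hl h, h1]
      · exact absurd (by simp only [blockLength, h0, if_false]; rw [if_neg h1]) hu

lemma zeroLength_spec :
    zeroLength d k ≤ k ∧ ∀ l, k - zeroLength d k < l → l ≤ k → d l = 0 := by
  induction k with
  | zero => exact ⟨le_rfl, fun l _ _ => by omega⟩
  | succ k ih =>
    by_cases h : d (k + 1) = 0
    · have hz : zeroLength d (k + 1) = zeroLength d k + 1 := if_pos h
      rw [hz, Nat.add_sub_add_right]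
      refine ⟨by omega, fun l hl hl' => ?_⟩
      rcases Nat.le_succ_iff.mp hl' with h' | rfl
      exacts [ih.2 l hl h', h]
    · have hz : zeroLength d (k + 1) = 0 := if_neg h
      rw [hz]
      exact ⟨by omega, fun l _ _ => by omega⟩

lemma blockLength_of_block (hl : Legal a d k) (h1 : d (k + 1) = a (k + 1) - 1) (j : ℕ)
    (hb : ∀ l, k + 1 < l → l ≤ k + 1 + j → d l = a l - 2) :
    blockLength a d (k + 1 + j) = j + 1 := by
  induction j with
  | zero =>
    have h0 : blockLength a d k = 0 := by
      by_contra h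
      have := hl.2.2 h
      omega
    rw [add_zero, blockLength_succ, if_pos h0, if_pos h1]
  | succ j ih =>
    have h := ih fun l h h' => hb l h (by omega)
    rw [← add_assoc, blockLength_succ, if_neg (by omega), if_pos (hb _ (by omega) (by omega)), h]

lemma le_zeroLength (j : ℕ) (hz : ∀ l, k < l → l ≤ k + j → d l = 0) :
    j ≤ zeroLength d (k + j) := by
  induction j with
  | zero => exact Nat.zero_le _
  | succ j ih =>
    have h := ih fun l h h' => hz l h (by omega)
    rw [← add_assoc, zeroLength_succ, if_pos (hz _ (by omega) (by omega))]
    omega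

lemma Alive.le {u z : ℕ} (hs : N ≤ s) (h : Alive a s N k u z) : u ≤ s ∧ z ≤ s := by
  rcases h with ⟨h1, h2⟩ | ⟨-, h⟩
  · omega
  · have := h 0 twos_zero
    omega

/-- Legal sequences avoiding the forbidden blocks are viable. -/
lemma viable_of_le (ha : ∀ i, 1 ≤ i → 2 ≤ a i) (hN : ∀ k j, Twos a k j → j < N)
    (hl : ∀ k, Legal a d k) (hb : ∀ k, blockLength a d k ≤ s) (hz : ∀ k, zeroLength d k ≤ s)
    (m : ℕ) : Viable a s N d m := by
  refine ⟨fun k _ => hl k, fun k _ => ?_⟩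
  by_cases hu : blockLength a d k = 0
  · exact Or.inl ⟨hu, hz k⟩
  refine Or.inr ⟨hu, fun j hj => ⟨?_, ?_⟩⟩
  · have : blockLength a d (k + j) = blockLength a d k + j := by
      induction j with
      | zero => rfl
      | succ j ih =>
        have h := ih fun i hi hi' => hj i hi (by omega)
        have h2 : a (k + j + 1) = 2 := hj _ (by omega) (by omega)
        have h3 := (hl (k + j)).2.2 (by omega)
        have h4 := (hl (k + j)).1
        rw [← add_assoc, blockLength_succ, if_neg (by omega), if_pos (by omega), h, add_assoc]
    exact this ▸ hb (k + j)
  · clear hb hz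
    induction k generalizing j with
    | zero => exact absurd rfl hu
    | succ k ih =>
      have hjN := hN _ _ hj
      have h2 := ha (k + 1) (by omega)
      by_cases hd : d (k + 1) = 0
      · have h0 : blockLength a d k ≠ 0 := fun h0 => hu <| by
          simp only [blockLength, h0, if_true]
          rw [if_neg (by omega)]
        have h2 : d (k + 1) = a (k + 1) - 2 := by
          by_contra h
          exact hu (by simp only [blockLength, h0, if_false]; rw [if_neg h])
        have := ih (by omega) h0 (j + 1) (hj.cons (by omega))
        have hz : zeroLength d (k + 1) = zeroLength d k + 1 := if_pos hd
        omega
      · have hz : zeroLength d (k + 1) = 0 := if_neg hd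
        omega

/-! ### Complete quotients -/

variable {α β : ℝ}

lemma ncq_props (hirr : Irrational α) (h0 : 0 < α) (h1 : α < 1) (i : ℕ) :
    Irrational (ncq α i) ∧ 0 < ncq α i ∧ ncq α i < 1 := by
  induction i with
  | zero => exact ⟨hirr, h0, h1⟩
  | succ i ih =>
    have hi : Irrational (ncq α (i + 1)) := ih.1.inv.intCast_sub _
    have hle : 0 ≤ ncq α (i + 1) := sub_nonneg.mpr (Int.le_ceil _)
    refine ⟨hi, lt_of_le_of_ne hle fun h => hi.ne_zero h.symm, ?_⟩
    have := Int.ceil_lt_add_one (ncq α i)⁻¹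
    simp only [ncq]
    linarith

lemma ncq_mul (hirr : Irrational α) (h0 : 0 < α) (h1 : α < 1) (i : ℕ) :
    ncq α i * (npq α (i + 1) - ncq α (i + 1)) = 1 := by
  have h := (ncq_props hirr h0 h1 i).2.1
  have : (npq α (i + 1) : ℝ) - ncq α (i + 1) = (ncq α i)⁻¹ := by
    simp only [npq, ncq, Nat.add_sub_cancel]
    ring
  rw [this, mul_inv_cancel₀ h.ne']

lemma two_le_npq (hirr : Irrational α) (h0 : 0 < α) (h1 : α < 1) (i : ℕ) :
    2 ≤ npq α i := by
  have h := (ncq_props hirr h0 h1 (i - 1)).2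
  have : (1 : ℤ) < npq α i := by
    rw [npq, Int.lt_ceil]
    simpa using (one_lt_inv₀ h.1).mpr h.2
  omega

/-! ### Real numbers with prescribed digits -/

/-- Upper bound for the remainder after the first `i` digits. -/
noncomputable def cap (α : ℝ) (d : ℕ → ℤ) (i : ℕ) : ℝ :=
  if blockLength (npq α) d i = 0 then 1 else 1 - ncq α i

lemma mul_add_le_cap (hirr : Irrational α) (h0 : 0 < α) (h1 : α < 1) {i : ℕ}
    (hl : Legal (npq α) d i) {y : ℝ} (hy : y ≤ cap α d (i + 1)) :
    ncq α i * (d (i + 1) + y) ≤ cap α d i ∧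
      (ncq α i * (d (i + 1) + y) = cap α d i →
        blockLength (npq α) d (i + 1) = blockLength (npq α) d i + 1 ∧ y = cap α d (i + 1)) := by
  obtain ⟨-, hp, -⟩ := ncq_props hirr h0 h1 i
  obtain ⟨-, hp', hlt'⟩ := ncq_props hirr h0 h1 (i + 1)
  have hm := ncq_mul hirr h0 h1 i
  obtain ⟨-, hd1, hd2⟩ := hl
  have key : ∀ r : ℤ, d (i + 1) ≤ npq α (i + 1) - r →
      (blockLength (npq α) d (i + 1) = if d (i + 1) = npq α (i + 1) - r then
        blockLength (npq α) d i + 1 else 0) →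
      ncq α i * (d (i + 1) + y) ≤ ncq α i * (npq α (i + 1) - (r - 1) - ncq α (i + 1)) ∧
      (ncq α i * (d (i + 1) + y) = ncq α i * (npq α (i + 1) - (r - 1) - ncq α (i + 1)) →
        blockLength (npq α) d (i + 1) = blockLength (npq α) d i + 1 ∧ y = cap α d (i + 1)) := by
    intro r hr hb
    by_cases h : d (i + 1) = npq α (i + 1) - r
    · rw [if_pos h] at hb
      have hc : cap α d (i + 1) = 1 - ncq α (i + 1) := by rw [cap, if_neg (by omega)]
      have hr' : (d (i + 1) : ℝ) = npq α (i + 1) - r := by exact_mod_cast h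
      refine ⟨mul_le_mul_of_nonneg_left (by linarith) hp.le, fun he => ⟨hb, ?_⟩⟩
      have := mul_left_cancel₀ hp.ne' he
      linarith
    · rw [if_neg h] at hb
      have hc : cap α d (i + 1) = 1 := by rw [cap, if_pos hb]
      have hr' : (d (i + 1) : ℝ) ≤ npq α (i + 1) - r - 1 := by
        have : d (i + 1) ≤ npq α (i + 1) - r - 1 := by omega
        exact_mod_cast this
      have hlt : (d (i + 1) : ℝ) + y < npq α (i + 1) - (r - 1) - ncq α (i + 1) := by linarith
      exact ⟨mul_le_mul_of_nonneg_left hlt.le hp.le,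
        fun he => absurd (mul_left_cancel₀ hp.ne' he) hlt.ne⟩
  by_cases hu : blockLength (npq α) d i = 0
  · have := key 1 hd1 (by simp only [blockLength, hu, if_true, zero_add])
    have hc : cap α d i = ncq α i * (npq α (i + 1) - ((1 : ℤ) - 1) - ncq α (i + 1)) := by
      rw [cap, if_pos hu]
      push_cast
      linarith
    rwa [hc]
  · have := key 2 (hd2 hu) (by simp only [blockLength, hu, if_false])
    have hc : cap α d i = ncq α i * (npq α (i + 1) - ((2 : ℤ) - 1) - ncq α (i + 1)) := by
      rw [cap, if_neg hu]
      push_cast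
      linarith
    rwa [hc]

/-- The series `d_{i+1} α_{i+1} + d_{i+2} α_{i+1} α_{i+2} + ⋯`, term by term. -/
noncomputable def digitTerm (α : ℝ) (d : ℕ → ℤ) (i k : ℕ) : ℝ :=
  d (i + k + 1) * ∏ j ∈ range (k + 1), ncq α (i + j)

lemma digitTerm_zero (i : ℕ) : digitTerm α d i 0 = ncq α i * d (i + 1) := by
  simp [digitTerm, mul_comm]

lemma digitTerm_succ (i k : ℕ) : digitTerm α d i (k + 1) = ncq α i * digitTerm α d (i + 1) k := by
  have h : ∀ j, i + (j + 1) = i + 1 + j := fun j => by omega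
  rw [digitTerm, digitTerm, prod_range_succ', h k, add_zero, prod_congr rfl fun j _ => by rw [h j]]
  ring

lemma sum_digitTerm_le_cap (hirr : Irrational α) (h0 : 0 < α) (h1 : α < 1)
    (hl : ∀ i, Legal (npq α) d i) (m i : ℕ) :
    ∑ k ∈ range m, digitTerm α d i k ≤ cap α d i := by
  induction m generalizing i with
  | zero =>
    have := (ncq_props hirr h0 h1 i).2.2
    rw [sum_range_zero, cap]
    split_ifs <;> linarith
  | succ m ih =>
    rw [sum_range_succ', digitTerm_zero]
    simp only [digitTerm_succ]
    rw [← mul_sum, ← mul_add, add_comm]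
    exact (mul_add_le_cap hirr h0 h1 (hl i) (ih (i + 1))).1

lemma exists_remainders (hirr : Irrational α) (h0 : 0 < α) (h1 : α < 1)
    (hl : ∀ i, Legal (npq α) d i) (hb : ∀ i, blockLength (npq α) d i ≤ s) :
    ∃ x : ℕ → ℝ, (∀ i, 0 ≤ x i ∧ x i < 1) ∧ ∀ i, x i = ncq α i * (d (i + 1) + x (i + 1)) := by
  have hnn : ∀ i k, 0 ≤ digitTerm α d i k := fun i k =>
    mul_nonneg (by exact_mod_cast (hl (i + k)).1)
      (prod_nonneg fun j _ => (ncq_props hirr h0 h1 (i + j)).2.1.le)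
  have hsum : ∀ i, Summable (digitTerm α d i) := fun i =>
    summable_of_sum_range_le (hnn i) fun m => sum_digitTerm_le_cap hirr h0 h1 hl m i
  have hle : ∀ i, ∑' k, digitTerm α d i k ≤ cap α d i := fun i =>
    Real.tsum_le_of_sum_range_le (hnn i) fun m => sum_digitTerm_le_cap hirr h0 h1 hl m i
  have hrec : ∀ i, ∑' k, digitTerm α d i k =
      ncq α i * (d (i + 1) + ∑' k, digitTerm α d (i + 1) k) := by
    intro i
    rw [(hsum i).tsum_eq_zero_add, digitTerm_zero]
    simp only [digitTerm_succ]
    rw [tsum_mul_left, mul_add]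
  refine ⟨fun i => ∑' k, digitTerm α d i k, fun i => ⟨tsum_nonneg (hnn i), ?_⟩, hrec⟩
  have hne : ∑' k, digitTerm α d i k ≠ cap α d i := by
    intro he
    have : ∀ j, blockLength (npq α) d (i + j) = blockLength (npq α) d i + j ∧
        ∑' k, digitTerm α d (i + j) k = cap α d (i + j) := by
      intro j
      induction j with
      | zero => exact ⟨rfl, he⟩
      | succ j ih =>
        have h := (mul_add_le_cap hirr h0 h1 (hl (i + j)) (hle (i + j + 1))).2
          (by rw [← hrec]; exact ih.2)
        exact ⟨by rw [← add_assoc, h.1, ih.1, add_assoc], h.2⟩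
    have h2 := (this (s + 1)).1
    have h3 := hb (i + (s + 1))
    omega
  have hlt := lt_of_le_of_ne (hle i) hne
  have hp := (ncq_props hirr h0 h1 i).2.1
  have hcap : cap α d i ≤ 1 := by
    rw [cap]
    split_ifs <;> linarith
  exact hlt.trans_le hcap

lemma mem_Fset_of_viable (hirr : Irrational α) (h0 : 0 < α) (h1 : α < 1) (hs : N ≤ s)
    (hv : ∀ k, Viable (npq α) s N d k) :
    ∃ β ∈ Fset α s, ∀ k, 1 ≤ k → db α β k = d k := by
  have hl : ∀ i, Legal (npq α) d i := fun i => (hv (i + 1)).1 i (by omega)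
  have hle := fun i => ((hv i).2 i le_rfl).le hs
  obtain ⟨x, hx, hrec⟩ := exists_remainders hirr h0 h1 hl fun i => (hle i).1
  have hdiv : ∀ i, x i / ncq α i = d (i + 1) + x (i + 1) := fun i => by
    rw [hrec i, mul_div_cancel_left₀ _ (ncq_props hirr h0 h1 i).2.1.ne']
  have hrem : ∀ i, drem α (x 0) i = x i := by
    intro i
    induction i with
    | zero => rfl
    | succ i ih =>
      rw [drem, ih, hdiv, Int.fract_intCast_add, Int.fract_eq_self.mpr (hx (i + 1))]
  have hdb : ∀ k, 1 ≤ k → db α (x 0) k = d k := by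
    intro k hk
    obtain ⟨k, rfl⟩ := Nat.exists_eq_add_of_le' hk
    rw [db, Nat.add_sub_cancel, hrem, hdiv, Int.floor_intCast_add,
      Int.floor_eq_zero_iff.mpr (hx (k + 1)), add_zero]
  refine ⟨x 0, ⟨(hx 0).1, (hx 0).2, fun i hi => ⟨?_, ?_⟩⟩, hdb⟩ <;>
    obtain ⟨i, rfl⟩ := Nat.exists_eq_add_of_le' hi
  · by_contra! hcon
    have h := le_zeroLength (d := d) (k := i) (s + 1) fun l hl hl' => by
      rw [← hdb l (by omega)]
      exact hcon l hl (by omega)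
    have := (hle (i + (s + 1))).2
    omega
  · rintro ⟨h2, h3⟩
    have h := blockLength_of_block (hl i) (by rw [← h2, hdb _ hi]) s fun l hl hl' => by
      rw [← hdb l (by omega)]
      exact h3 l hl hl'
    have := (hle (i + 1 + s)).1
    omega

/-! ### Digits of a real number -/

lemma drem_mem (hβ : 0 ≤ β ∧ β < 1) (i : ℕ) : 0 ≤ drem α β i ∧ drem α β i < 1 := by
  cases i with
  | zero => exact hβ
  | succ i => exact ⟨Int.fract_nonneg _, Int.fract_lt_one _⟩

lemma drem_eq (hirr : Irrational α) (h0 : 0 < α) (h1 : α < 1) (i : ℕ) :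
    drem α β i = ncq α i * (db α β (i + 1) + drem α β (i + 1)) := by
  rw [drem, db, Nat.add_sub_cancel, Int.floor_add_fract, mul_div_cancel₀]
  exact (ncq_props hirr h0 h1 i).2.1.ne'

lemma drem_lt_cap_and_legal (hirr : Irrational α) (h0 : 0 < α) (h1 : α < 1)
    (hβ : 0 ≤ β ∧ β < 1) (i : ℕ) :
    drem α β i < cap α (db α β) i ∧ Legal (npq α) (db α β) i := by
  have legal : ∀ i, drem α β i < cap α (db α β) i → Legal (npq α) (db α β) i := by
    intro i hi
    obtain ⟨-, hp, -⟩ := ncq_props hirr h0 h1 i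
    obtain ⟨-, hp', -⟩ := ncq_props hirr h0 h1 (i + 1)
    have hm := ncq_mul hirr h0 h1 i
    have hx := drem_eq (β := β) hirr h0 h1 i
    have hx' := (drem_mem (α := α) hβ (i + 1)).1
    have hlt := (drem_mem (α := α) hβ i).2
    refine ⟨Int.floor_nonneg.mpr (div_nonneg (drem_mem hβ i).1 hp.le), ?_, fun hu => ?_⟩
    · have : ncq α i * (db α β (i + 1) + drem α β (i + 1)) <
          ncq α i * (npq α (i + 1) - ncq α (i + 1)) := by linarith
      have := lt_of_mul_lt_mul_left this hp.le
      have : (db α β (i + 1) : ℝ) < npq α (i + 1) := by linarith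
      have : db α β (i + 1) < npq α (i + 1) := by exact_mod_cast this
      omega
    · rw [cap, if_neg hu] at hi
      have : ncq α i * (db α β (i + 1) + drem α β (i + 1)) <
          ncq α i * (npq α (i + 1) - ncq α (i + 1) - 1) := by linarith
      have := lt_of_mul_lt_mul_left this hp.le
      have : (db α β (i + 1) : ℝ) < npq α (i + 1) - 1 := by linarith
      have : db α β (i + 1) < npq α (i + 1) - 1 := by exact_mod_cast this
      omega
  refine ⟨?_, legal i ?_⟩ <;>
  · induction i with
    | zero => simpa [cap, blockLength, drem] using hβ.2
    | succ i ih =>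
      obtain ⟨-, hp, -⟩ := ncq_props hirr h0 h1 i
      have hm := ncq_mul hirr h0 h1 i
      have hx := drem_eq (β := β) hirr h0 h1 i
      rw [cap]
      split_ifs with hu
      · exact (drem_mem hβ (i + 1)).2
      · by_cases hi : blockLength (npq α) (db α β) i = 0
        · rw [cap, if_pos hi] at ih
          simp only [blockLength, hi, if_true, ite_eq_right_iff, one_ne_zero, imp_false,
            not_not] at hu
          have hr : (db α β (i + 1) : ℝ) = npq α (i + 1) - 1 := by exact_mod_cast hu
          have : ncq α i * (db α β (i + 1) + drem α β (i + 1)) <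
              ncq α i * (npq α (i + 1) - ncq α (i + 1)) := by linarith
          have := lt_of_mul_lt_mul_left this hp.le
          linarith
        · rw [cap, if_neg hi] at ih
          simp only [blockLength, hi, if_false, ite_eq_right_iff, Nat.succ_ne_zero, imp_false,
            not_not] at hu
          have hr : (db α β (i + 1) : ℝ) = npq α (i + 1) - 2 := by exact_mod_cast hu
          have : ncq α i * (db α β (i + 1) + drem α β (i + 1)) <
              ncq α i * (npq α (i + 1) - ncq α (i + 1) - 1) := by linarith
          have := lt_of_mul_lt_mul_left this hp.le
          linarith

lemma viable_db (hirr : Irrational α) (h0 : 0 < α) (h1 : α < 1)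
    (hN : ∀ k j, Twos (npq α) k j → j < N) (hβ : β ∈ Fset α s) (m : ℕ) :
    Viable (npq α) s N (db α β) m := by
  refine viable_of_le (fun i _ => two_le_npq hirr h0 h1 i) hN
    (fun k => (drem_lt_cap_and_legal hirr h0 h1 ⟨hβ.1, hβ.2.1⟩ k).2) (fun k => ?_) (fun k => ?_) m
  · by_contra! hcon
    obtain ⟨h2, h3, h4⟩ := blockLength_spec (a := npq α) (d := db α β) (k := k) (by omega)
    exact (hβ.2.2 _ (by omega)).2 ⟨h3, fun l hl hl' => h4 l hl (by omega)⟩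
  · by_contra! hcon
    obtain ⟨h2, h3⟩ := zeroLength_spec (d := db α β) (k := k)
    obtain ⟨l, hl, hl', hne⟩ := (hβ.2.2 (k - zeroLength (db α β) k + 1) (by omega)).1
    exact hne (h3 l (by omega) (by omega))

lemma Dk_pos (hirr : Irrational α) (h0 : 0 < α) (h1 : α < 1) (k : ℕ) : 0 < Dk α k :=
  prod_pos fun j _ => (ncq_props hirr h0 h1 j).2.1

lemma Dk_succ (k : ℕ) : Dk α (k + 1) = Dk α k * ncq α k := prod_range_succ _ _

lemma Dk_antitone (hirr : Irrational α) (h0 : 0 < α) (h1 : α < 1) : Antitone (Dk α) :=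
  antitone_nat_of_succ_le fun k => by
    rw [Dk_succ]
    exact mul_le_of_le_one_right (Dk_pos hirr h0 h1 k).le (ncq_props hirr h0 h1 k).2.2.le

lemma Dk_mul_drem (hirr : Irrational α) (h0 : 0 < α) (h1 : α < 1) (k : ℕ) :
    Dk α k * drem α β k = Dk α (k + 1) * (db α β (k + 1) + drem α β (k + 1)) := by
  rw [drem_eq hirr h0 h1, Dk_succ, mul_assoc]

lemma Dk_mul_drem_of_zero (hirr : Irrational α) (h0 : 0 < α) (h1 : α < 1) (k j : ℕ)
    (hz : ∀ l, k < l → l ≤ k + j → db α β l = 0) :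
    Dk α k * drem α β k = Dk α (k + j) * drem α β (k + j) := by
  induction j with
  | zero => rfl
  | succ j ih =>
    rw [ih fun l h h' => hz l h (by omega), Dk_mul_drem hirr h0 h1,
      hz (k + j + 1) (by omega) (by omega), Int.cast_zero, zero_add, add_assoc]

lemma drem_pos (hβ : β ∈ Fset α s) (k : ℕ) :
    0 < drem α β k := by
  refine lt_of_le_of_ne (drem_mem ⟨hβ.1, hβ.2.1⟩ k).1 fun he => ?_
  have hz : ∀ j, drem α β (k + j) = 0 := by
    intro j
    induction j with
    | zero => exact he.symm
    | succ j ih => rw [← add_assoc, drem, ih, zero_div, Int.fract_zero]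
  obtain ⟨l, hl, -, hne⟩ := (hβ.2.2 (k + 1) (by omega)).1
  obtain ⟨j, rfl⟩ := Nat.exists_eq_add_of_le hl
  refine hne ?_
  rw [db, show k + 1 + j - 1 = k + j by omega, hz, zero_div, Int.floor_zero]

lemma Dk_sub_of_block (hirr : Irrational α) (h0 : 0 < α) (h1 : α < 1) (k j : ℕ)
    (hd : db α β (k + 1) = npq α (k + 1) - 1)
    (hb : ∀ l, k + 1 < l → l ≤ k + 1 + j → db α β l = npq α l - 2) :
    Dk α k - Dk α k * drem α β k =
      Dk α (k + 1 + j) * (1 - ncq α (k + 1 + j) - drem α β (k + 1 + j)) := by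
  have hD : ∀ i, Dk α i = Dk α (i + 1) * (npq α (i + 1) - ncq α (i + 1)) := fun i => by
    rw [Dk_succ, mul_assoc, ncq_mul hirr h0 h1, mul_one]
  induction j with
  | zero =>
    rw [Dk_mul_drem hirr h0 h1, hD k, hd]
    push_cast
    simp only [add_zero]
    ring
  | succ j ih =>
    have hd' : (db α β (k + 1 + j + 1) : ℝ) = npq α (k + 1 + j + 1) - 2 := by
      exact_mod_cast hb (k + 1 + j + 1) (by omega) (by omega)
    rw [ih fun l h h' => hb l h (by omega), mul_sub, mul_sub, mul_one, ← Dk_succ,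
      Dk_mul_drem hirr h0 h1, hD (k + 1 + j), hd']
    simp only [← add_assoc]
    ring

lemma eq_Sval_add (hirr : Irrational α) (h0 : 0 < α) (h1 : α < 1) (n : ℕ) :
    β = Sval α n (db α β) + Dk α n * drem α β n := by
  induction n with
  | zero => simp [Sval, Dk, drem]
  | succ n ih =>
    rw [Dk_mul_drem hirr h0 h1] at ih
    rw [Sval, sum_Icc_succ_top (by omega), ← Sval]
    linarith

/-! ### Cylinders -/

variable {n : ℕ} {c : ℕ → ℤ}

lemma eq_of_mem_Fcyl (hirr : Irrational α) (h0 : 0 < α) (h1 : α < 1) (hβ : β ∈ Fcyl α s n c) :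
    β = Sval α n c + Dk α n * drem α β n := by
  have : Sval α n c = Sval α n (db α β) := sum_congr rfl fun k hk => by
    rw [mem_Icc] at hk
    rw [hβ.2 k hk.1 hk.2]
  rw [this]
  exact eq_Sval_add hirr h0 h1 n

lemma sInf_le_of_mem (hβ : β ∈ Fcyl α s n c) : sInf (Fcyl α s n c) ≤ β :=
  csInf_le ⟨0, fun _ h => h.1.1⟩ hβ

lemma le_sSup_of_mem (hβ : β ∈ Fcyl α s n c) : β ≤ sSup (Fcyl α s n c) :=
  le_csSup ⟨1, fun _ h => h.1.2.1.le⟩ hβ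

/-- A viable word extending `c` is the beginning of an element of `F(c)`. -/
lemma exists_mem_Fcyl (hirr : Irrational α) (h0 : 0 < α) (h1 : α < 1)
    (hN : ∀ k j, Twos (npq α) k j → j < N) (hs : N ≤ s) (hv : Viable (npq α) s N d m)
    (hnm : n ≤ m) (hd : ∀ k, 1 ≤ k → k ≤ n → d k = c k) :
    ∃ β ∈ Fcyl α s n c, ∀ k, 1 ≤ k → k ≤ m → db α β k = d k := by
  obtain ⟨e, he, hv'⟩ := hv.exists_extension (fun i _ => two_le_npq hirr h0 h1 i) hN hs
  obtain ⟨β, hβ, hdb⟩ := mem_Fset_of_viable hirr h0 h1 hs hv'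
  have : ∀ k, 1 ≤ k → k ≤ m → db α β k = d k := fun k hk hk' => by rw [hdb k hk, he k hk hk']
  exact ⟨β, ⟨hβ, fun k hk hk' => by rw [this k hk (by omega), hd k hk hk']⟩, this⟩

lemma sInf_lt_of_zeroLength_eq_zero (hirr : Irrational α) (h0 : 0 < α) (h1 : α < 1)
    (hN : ∀ k j, Twos (npq α) k j → j < N) (hs : N ≤ s) (hv : Viable (npq α) s N c n)
    (hz : zeroLength c n = 0) :
    sInf (Fcyl α s n c) < Sval α n c + Dk α (n + s) := by
  set d : ℕ → ℤ := fun k => if k ≤ n then c k else 0 with hd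
  have hdc : ∀ k, 1 ≤ k → k ≤ n → d k = c k := fun k _ hk => if_pos hk
  have hd0 : ∀ k, n < k → d k = 0 := fun k hk => if_neg (by omega)
  have hv' := ((hv.congr hdc).succ_iterate_zero (fun i _ => two_le_npq hirr h0 h1 i) hs s
    (by rw [zeroLength_congr hdc]; omega) fun i hi _ => hd0 i hi).1
  obtain ⟨β, hβ, hdb⟩ := exists_mem_Fcyl hirr h0 h1 hN hs hv' (by omega) hdc
  refine (sInf_le_of_mem hβ).trans_lt ?_
  have h := eq_of_mem_Fcyl hirr h0 h1 hβ
  rw [Dk_mul_drem_of_zero hirr h0 h1 n s fun l hl hl' => by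
    rw [hdb l (by omega) hl', hd0 l hl]] at h
  have hlt := (drem_mem (α := α) ⟨hβ.1.1, hβ.1.2.1⟩ (n + s)).2
  have := mul_lt_mul_of_pos_left hlt (Dk_pos hirr h0 h1 (n + s))
  linarith

lemma sInf_lt_add (hirr : Irrational α) (h0 : 0 < α) (h1 : α < 1)
    (hN : ∀ k j, Twos (npq α) k j → j < N) (hs1 : 1 ≤ s) (hs : N ≤ s)
    (hv : Viable (npq α) s N c n) :
    sInf (Fcyl α s n c) < Sval α n c + Dk α (n + 1) + Dk α (n + s) := by
  have h2 : ∀ i, 1 ≤ i → 2 ≤ npq α i := fun i _ => two_le_npq hirr h0 h1 i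
  by_cases hu : blockLength (npq α) c n = 0
  · set d : ℕ → ℤ := fun k => if k ≤ n then c k else if k = n + 1 then 1 else 0 with hd
    have hdc : ∀ k, 1 ≤ k → k ≤ n → d k = c k := fun k _ hk => if_pos hk
    have hd1 : d (n + 1) = 1 := by simp [hd]
    have hd0 : ∀ k, n + 1 < k → d k = 0 := fun k hk => by
      simp only [hd]
      rw [if_neg (by omega), if_neg (by omega)]
    have h3 := h2 (n + 1) (by omega)
    have hv1 : Viable (npq α) s N d (n + 1) := (hv.congr hdc).succ_pos hN hs
      (by rw [blockLength_congr hdc, hu]) (by omega) (by omega)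
    have hz : zeroLength d (n + 1) = 0 := if_neg (by omega)
    have hv' := (hv1.succ_iterate_zero h2 hs (s - 1) (by omega) fun i hi _ => hd0 i hi).1
    obtain ⟨β, hβ, hdb⟩ := exists_mem_Fcyl hirr h0 h1 hN hs hv' (by omega) hdc
    refine (sInf_le_of_mem hβ).trans_lt ?_
    have h := eq_of_mem_Fcyl hirr h0 h1 hβ
    rw [Dk_mul_drem hirr h0 h1, hdb _ (by omega) (by omega), hd1, mul_add,
      Dk_mul_drem_of_zero hirr h0 h1 (n + 1) (s - 1) fun l hl hl' => by
      rw [hdb l (by omega) hl', hd0 l hl], show n + 1 + (s - 1) = n + s by omega] at h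
    have hlt := (drem_mem (α := α) ⟨hβ.1.1, hβ.1.2.1⟩ (n + s)).2
    have := mul_lt_mul_of_pos_left hlt (Dk_pos hirr h0 h1 (n + s))
    push_cast at h
    linarith
  · set d : ℕ → ℤ := fun k => if k ≤ n then c k else 0 with hd
    have hdc : ∀ k, 1 ≤ k → k ≤ n → d k = c k := fun k _ hk => if_pos hk
    have hd1 : d (n + 1) = 0 := if_neg (by omega)
    have hv1 : Viable (npq α) s N d (n + 1) := (hv.congr hdc).succ_zero h2 hs hd1
      fun h => absurd (by rw [← h, blockLength_congr hdc]) hu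
    obtain ⟨β, hβ, hdb⟩ := exists_mem_Fcyl hirr h0 h1 hN hs hv1 (by omega) hdc
    refine (sInf_le_of_mem hβ).trans_lt ?_
    have h := eq_of_mem_Fcyl hirr h0 h1 hβ
    rw [Dk_mul_drem hirr h0 h1, hdb _ (by omega) le_rfl, hd1, Int.cast_zero, zero_add] at h
    have hlt := (drem_mem (α := α) ⟨hβ.1.1, hβ.1.2.1⟩ (n + 1)).2
    have := mul_lt_mul_of_pos_left hlt (Dk_pos hirr h0 h1 (n + 1))
    have := Dk_pos hirr h0 h1 (n + s)
    linarith

lemma lt_sSup_of_blockLength_eq_zero (hirr : Irrational α) (h0 : 0 < α) (h1 : α < 1)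
    (hN : ∀ k j, Twos (npq α) k j → j < N) (hs : N ≤ s) (hv : Viable (npq α) s N c n)
    (hu : blockLength (npq α) c n = 0) :
    Sval α n c + Dk α n - Dk α (n + s - N) < sSup (Fcyl α s n c) := by
  have h2 : ∀ i, 1 ≤ i → 2 ≤ npq α i := fun i _ => two_le_npq hirr h0 h1 i
  rcases Nat.eq_or_lt_of_le hs with rfl | hlt
  · obtain ⟨β, hβ, -⟩ := exists_mem_Fcyl (c := c) hirr h0 h1 hN hs hv le_rfl fun _ _ _ => rfl
    refine lt_of_lt_of_le ?_ (le_sSup_of_mem hβ)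
    have h := eq_of_mem_Fcyl hirr h0 h1 hβ
    have := mul_pos (Dk_pos hirr h0 h1 n) (drem_pos hβ.1 n)
    rw [Nat.add_sub_cancel]
    linarith
  · obtain ⟨p, rfl⟩ := Nat.exists_eq_add_of_lt hlt
    set d : ℕ → ℤ := fun k =>
      if k ≤ n then c k else if k = n + 1 then npq α k - 1 else npq α k - 2 with hd
    have hdc : ∀ k, 1 ≤ k → k ≤ n → d k = c k := fun k _ hk => if_pos hk
    have hd1 : d (n + 1) = npq α (n + 1) - 1 := by simp [hd]
    have hd2 : ∀ k, n + 1 < k → d k = npq α k - 2 := fun k hk => by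
      simp only [hd]
      rw [if_neg (by omega), if_neg (by omega)]
    have h3 := h2 (n + 1) (by omega)
    have hv1 : Viable (npq α) (N + p + 1) N d (n + 1) := (hv.congr hdc).succ_pos hN hs
      (by rw [blockLength_congr hdc, hu]) (by omega) (by omega)
    have hv' : ∀ j ≤ p, Viable (npq α) (N + p + 1) N d (n + 1 + j) := by
      intro j hj
      induction j with
      | zero => exact hv1
      | succ j ih =>
        have hb := blockLength_of_block (hv1.1 n (by omega)) hd1 j fun l hl _ => hd2 l hl
        rw [← add_assoc]
        exact (ih (by omega)).succ_block h2 hN (by omega) (hd2 _ (by omega)) (by omega)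
    obtain ⟨β, hβ, hdb⟩ := exists_mem_Fcyl hirr h0 h1 hN hs (hv' p le_rfl) (by omega) hdc
    refine lt_of_lt_of_le ?_ (le_sSup_of_mem hβ)
    have h := eq_of_mem_Fcyl hirr h0 h1 hβ
    have hsub := Dk_sub_of_block (β := β) hirr h0 h1 n p
      (by rw [hdb _ (by omega) (by omega), hd1])
      fun l hl hl' => by rw [hdb _ (by omega) hl', hd2 l hl]
    have hx := (drem_mem (α := α) ⟨hβ.1.1, hβ.1.2.1⟩ (n + 1 + p)).1
    have hp := (ncq_props hirr h0 h1 (n + 1 + p)).2.1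
    have := mul_lt_mul_of_pos_left
      (show 1 - ncq α (n + 1 + p) - drem α β (n + 1 + p) < 1 by linarith)
      (Dk_pos hirr h0 h1 (n + 1 + p))
    rw [show n + (N + p + 1) - N = n + 1 + p by omega]
    linarith

lemma lt_sSup_of_blockLength_ne_zero (hirr : Irrational α) (h0 : 0 < α) (h1 : α < 1)
    (hN : ∀ k j, Twos (npq α) k j → j < N) (hs : N ≤ s) (hv : Viable (npq α) s N c n)
    (hu : blockLength (npq α) c n ≠ 0) :
    Sval α n c + Dk α (n + N + 1) < sSup (Fcyl α s n c) := by
  have h2 : ∀ i, 1 ≤ i → 2 ≤ npq α i := fun i _ => two_le_npq hirr h0 h1 i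
  have hex : ∃ r, npq α (n + r + 1) ≠ 2 := by
    by_contra! hcon
    refine lt_irrefl N (hN n N fun i hi _ => ?_)
    obtain ⟨r, rfl⟩ := Nat.exists_eq_add_of_lt hi
    exact hcon r
  classical
  obtain ⟨r, hr, hmin⟩ : ∃ r, npq α (n + r + 1) ≠ 2 ∧ Twos (npq α) n r := by
    refine ⟨Nat.find hex, Nat.find_spec hex, fun i hi hi' => ?_⟩
    obtain ⟨r, rfl⟩ := Nat.exists_eq_add_of_lt hi
    exact not_not.mp (Nat.find_min hex (by omega))
  have hrN := hN _ _ hmin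
  set d : ℕ → ℤ := fun k => if k ≤ n then c k else if k ≤ n + r + 1 then 0 else 1 with hd
  have hdc : ∀ k, 1 ≤ k → k ≤ n → d k = c k := fun k _ hk => if_pos hk
  have hd0 : ∀ k, n < k → k ≤ n + r + 1 → d k = 0 := fun k hk hk' => by
    simp only [hd]
    rw [if_neg (by omega), if_pos (by omega)]
  have hd1 : d (n + r + 1 + 1) = 1 := by
    simp only [hd]
    rw [if_neg (by omega), if_neg (by omega)]
  have hu' : blockLength (npq α) d n ≠ 0 := by rwa [blockLength_congr hdc]
  have hv0 : ∀ j ≤ r, Viable (npq α) s N d (n + j) ∧ blockLength (npq α) d (n + j) ≠ 0 := by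
    intro j hj
    induction j with
    | zero => exact ⟨hv.congr hdc, hu'⟩
    | succ j ih =>
      obtain ⟨hvj, huj⟩ := ih (by omega)
      have hdj : d (n + j + 1) = 0 := hd0 _ (by omega) (by omega)
      refine ⟨hvj.succ_zero h2 hs hdj fun h => absurd h huj, ?_⟩
      have h4 := hmin (n + j + 1) (by omega) (by omega)
      rw [← add_assoc, blockLength_succ, if_neg huj, if_pos (by omega)]
      omega
  obtain ⟨hvr, hur⟩ := hv0 r le_rfl
  have hdr := hd0 (n + r + 1) (by omega) le_rfl
  have hv1 := hvr.succ_zero h2 hs hdr fun h => absurd h hur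
  have hu1 : blockLength (npq α) d (n + r + 1) = 0 := by
    rw [blockLength_succ, if_neg hur, if_neg (by omega)]
  have h3 := h2 (n + r + 1 + 1) (by omega)
  have hv2 := hv1.succ_pos hN hs hu1 (by omega) (by omega)
  obtain ⟨β, hβ, hdb⟩ := exists_mem_Fcyl hirr h0 h1 hN hs hv2 (by omega) hdc
  refine lt_of_lt_of_le ?_ (le_sSup_of_mem hβ)
  have h := eq_of_mem_Fcyl hirr h0 h1 hβ
  rw [Dk_mul_drem_of_zero hirr h0 h1 n (r + 1) fun l hl hl' => by
    rw [hdb l (by omega) (by omega), hd0 l hl hl'], ← add_assoc, Dk_mul_drem hirr h0 h1,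
    hdb _ (by omega) le_rfl, hd1] at h
  have hD : Dk α (n + N + 1) ≤ Dk α (n + r + 1 + 1) := Dk_antitone hirr h0 h1 (by omega)
  have := mul_pos (Dk_pos hirr h0 h1 (n + r + 1 + 1)) (drem_pos hβ.1 (n + r + 1 + 1))
  push_cast at h
  linarith

end Davenport

/-- endpoint estimates for the cylinder intervals of the Cantor dissection
of `F(α,s)`.  Here `C̲(c) = sInf (F(c))` and `C̄(c) = sSup (F(c))` are the endpoints of the
smallest closed interval containing the nonempty set `F(c)`. -/
theorem stmt18 (α : ℝ) (hirr : Irrational α) (h0 : 0 < α) (h1 : α < 1)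
    (M N : ℕ) (hM0 : 0 < M) (hN0 : 1 ≤ N)
    (hM : ∀ i : ℕ, 1 ≤ i → npq α i ≤ (M : ℤ))
    (hN : ¬ ∃ i : ℕ, 1 ≤ i ∧ ∀ k : ℕ, i ≤ k → k < i + N → npq α k = 2)
    (s : ℕ) (hs : N ≤ s)
    (n : ℕ) (c : ℕ → ℤ)
    (hc : ∀ k : ℕ, 1 ≤ k → k ≤ n → 0 ≤ c k ∧ c k ≤ npq α k - 1)
    (hne : (Fcyl α s n c).Nonempty)
    (t : ℕ) (ht : t ≤ n)
    (htz : ∀ k : ℕ, n - t < k → k ≤ n → c k = 0)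
    (htmax : t = n ∨ c (n - t) ≠ 0)
    (u : ℕ) (hu : u ≤ n)
    (humatch :
      (0 < u ∧ c (n - u + 1) = npq α (n - u + 1) - 1 ∧
        ∀ k : ℕ, n - u + 1 < k → k ≤ n → c k = npq α k - 2) ∨
      (u = 0 ∧ ∀ m : ℕ, 1 ≤ m → m ≤ n →
        ¬ (c (n - m + 1) = npq α (n - m + 1) - 1 ∧
            ∀ k : ℕ, n - m + 1 < k → k ≤ n → c k = npq α k - 2))) :
    (if t = 0 then sInf (Fcyl α s n c) < Sval α n c + Dk α (n + s)
     else sInf (Fcyl α s n c) < Sval α n c + Dk α (n + 1) + Dk α (n + s)) ∧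
    (if u = 0 then Sval α n c + Dk α n - Dk α (n + s - N) < sSup (Fcyl α s n c)
     else Sval α n c + Dk α (n + N + 1) < sSup (Fcyl α s n c)) := by
  have hN' : ∀ k j, Davenport.Twos (npq α) k j → j < N := by
    intro k j hj
    by_contra! hcon
    exact hN ⟨k + 1, by omega, fun i hi hi' => hj i (by omega) (by omega)⟩
  obtain ⟨β, hβ⟩ := hne
  have hv : Davenport.Viable (npq α) s N c n :=
    (Davenport.viable_db hirr h0 h1 hN' hβ.1 n).congr fun i hi hi' => (hβ.2 i hi hi').symm
  refine ⟨?_, ?_⟩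
  · split_ifs with h
    · subst h
      refine Davenport.sInf_lt_of_zeroLength_eq_zero hirr h0 h1 hN' hs hv ?_
      cases n with
      | zero => rfl
      | succ n => exact if_neg (htmax.resolve_left (by omega))
    · exact Davenport.sInf_lt_add hirr h0 h1 hN' (hN0.trans hs) hs hv
  · split_ifs with h
    · refine Davenport.lt_sSup_of_blockLength_eq_zero hirr h0 h1 hN' hs hv ?_
      by_contra hb
      obtain ⟨h2, h3⟩ := Davenport.blockLength_spec hb
      exact (humatch.resolve_left (by omega)).2 _ (Nat.one_le_iff_ne_zero.mpr hb) h2 h3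
    · refine Davenport.lt_sSup_of_blockLength_ne_zero hirr h0 h1 hN' hs hv ?_
      obtain ⟨-, h2, h3⟩ := humatch.resolve_right (by omega)
      have hb := Davenport.blockLength_of_block (hv.1 (n - u) (by omega)) h2 (u - 1)
        fun l hl hl' => h3 l hl (by omega)
      rw [show n - u + 1 + (u - 1) = n by omega] at hb
      omega
end
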